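/- arXiv:1309.1970 — 2 statements merged into one kernel-verified Lean document; each statement's English description precedes it below -/
import Mathlib

section
/- Let n ≥ 2, U ⊆ ℝ^m, and let u ↦ H(u) assign to each u ∈ U an n×n complex Hermitian matrix, depending smoothly on u. Then the control system i·ψ̇(t) = H(u(t))·ψ(t) on the unit sphere S^{2n−1} ⊂ ℂ^n is approximately controllable if and only if it is exactly controllable. -/
attribute [local instance] Matrix.normedAddCommGroup Matrix.normedSpace

open MeasureTheory in
/-- A control `u : [0,T] → U` which is measurable and (essentially) bounded. -/
def IsAdmissibleControl {m : ℕ} (U : Set (EuclideanSpace ℝ (Fin m))) (T : ℝ)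
    (u : ℝ → EuclideanSpace ℝ (Fin m)) : Prop :=
  AEStronglyMeasurable u (volume.restrict (Set.Icc 0 T)) ∧
  (∀ t ∈ Set.Icc 0 T, u t ∈ U) ∧ ∃ C : ℝ, ∀ t ∈ Set.Icc 0 T, ‖u t‖ ≤ C

/-- An admissible trajectory of the lifted system `i·ġ(t) = H(u(t))·g(t)` on the
unitary group: an absolutely continuous curve in `U(n)` solving the equation almost
everywhere on `[0,T]`, encoded in integral form. -/
def IsLiftedTrajectory {n m : ℕ}
    (Hmat : EuclideanSpace ℝ (Fin m) → Matrix (Fin n) (Fin n) ℂ) (T : ℝ)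
    (u : ℝ → EuclideanSpace ℝ (Fin m)) (g : ℝ → Matrix (Fin n) (Fin n) ℂ) : Prop :=
  (∀ t ∈ Set.Icc 0 T, g t ∈ Matrix.unitaryGroup (Fin n) ℂ) ∧
  @IntervalIntegrable (Matrix (Fin n) (Fin n) ℂ)
    PseudoMetricSpace.toUniformSpace.toTopologicalSpace _
    (fun s => (-Complex.I) • (Hmat (u s) * g s))
    MeasureTheory.volume 0 T ∧
  ∀ t ∈ Set.Icc 0 T, g t = g 0 + ∫ s in (0:ℝ)..t, (-Complex.I) • (Hmat (u s) * g s)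

/-- The reachable set from `g0` of the lifted system on the unitary group. -/
def liftedReachable {n m : ℕ} (U : Set (EuclideanSpace ℝ (Fin m)))
    (Hmat : EuclideanSpace ℝ (Fin m) → Matrix (Fin n) (Fin n) ℂ)
    (g0 : Matrix (Fin n) (Fin n) ℂ) : Set (Matrix (Fin n) (Fin n) ℂ) :=
  {g1 | ∃ T : ℝ, 0 ≤ T ∧ ∃ u g, IsAdmissibleControl U T u ∧
    IsLiftedTrajectory Hmat T u g ∧ g 0 = g0 ∧ g T = g1}

/-- An admissible trajectory of the system `i·ψ̇(t) = H(u(t))·ψ(t)` on the unit sphere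
of `ℂ^n`: an absolutely continuous curve in the sphere solving the equation almost
everywhere on `[0,T]`, encoded in integral form. -/
def IsSphereTrajectory {n m : ℕ}
    (Hmat : EuclideanSpace ℝ (Fin m) → Matrix (Fin n) (Fin n) ℂ) (T : ℝ)
    (u : ℝ → EuclideanSpace ℝ (Fin m)) (ψ : ℝ → EuclideanSpace ℂ (Fin n)) : Prop :=
  (∀ t ∈ Set.Icc 0 T, ψ t ∈ Metric.sphere (0 : EuclideanSpace ℂ (Fin n)) 1) ∧
  IntervalIntegrable (fun s => (-Complex.I) • Matrix.toEuclideanLin (Hmat (u s)) (ψ s))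
    MeasureTheory.volume 0 T ∧
  ∀ t ∈ Set.Icc 0 T,
    ψ t = ψ 0 + ∫ s in (0:ℝ)..t, (-Complex.I) • Matrix.toEuclideanLin (Hmat (u s)) (ψ s)

/-- The reachable set from `ψ0` of the system on the unit sphere of `ℂ^n`. -/
def sphereReachable {n m : ℕ} (U : Set (EuclideanSpace ℝ (Fin m)))
    (Hmat : EuclideanSpace ℝ (Fin m) → Matrix (Fin n) (Fin n) ℂ)
    (ψ0 : EuclideanSpace ℂ (Fin n)) : Set (EuclideanSpace ℂ (Fin n)) :=
  {ψ1 | ∃ T : ℝ, 0 ≤ T ∧ ∃ u ψ, IsAdmissibleControl U T u ∧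
    IsSphereTrajectory Hmat T u ψ ∧ ψ 0 = ψ0 ∧ ψ T = ψ1}

namespace SphereCtl
open NormedSpace Filter Topology

section
variable {E : Type*} [NormedAddCommGroup E] [InnerProductSpace ℂ E] [FiniteDimensional ℂ E]

theorem exp_eig (X : E →L[ℂ] E) (v : E) (c : ℂ) (h : X v = c • v) :
    (exp X) v = Complex.exp c • v := by
  have : CompleteSpace E := FiniteDimensional.complete ℂ E
  have hp : ∀ k : ℕ, (X ^ k) v = c ^ k • v := by
    intro k
    induction k with
    | zero => simp
    | succ k ih => rw [pow_succ, mul_apply_eq_comp, h, map_smul, ih, smul_smul,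
        pow_succ, mul_comm]
  have h1 := (exp_series_hasSum_exp' (𝕂 := ℂ) X)
  have h2 := h1.mapL (ContinuousLinearMap.apply ℂ E v)
  have h3 := (exp_series_hasSum_exp' (𝕂 := ℂ) c).smul_const v
  rw [← Complex.exp_eq_exp_ℂ] at h3
  refine h2.unique ?_
  convert h3 using 2 with k
  simp [hp, smul_smul]

theorem det_exp_skew (X : E →L[ℂ] E) (hX : star X = -X) :
    LinearMap.det ((exp X : E →L[ℂ] E) : E →ₗ[ℂ] E) =
      Complex.exp (LinearMap.trace ℂ E (X : E →ₗ[ℂ] E)) := by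
  have : CompleteSpace E := FiniteDimensional.complete ℂ E
  have hT : IsSelfAdjoint (Complex.I • X) := by
    rw [IsSelfAdjoint, star_smul, hX]
    simp
  have hS := (ContinuousLinearMap.isSelfAdjoint_iff_isSymmetric.mp hT)
  set b := hS.eigenvectorBasis rfl with hb
  have hXb : ∀ i, X (b i) = (-Complex.I * (hS.eigenvalues rfl i : ℂ)) • b i := by
    intro i
    have := hS.apply_eigenvectorBasis rfl i
    rw [← hb] at this
    rw [mul_smul]
    erw [← this]
    simp [smul_smul]
  have hE := fun i => exp_eig X (b i) _ (hXb i)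
  have h1 : LinearMap.trace ℂ E (X : E →ₗ[ℂ] E) = ∑ i, (-Complex.I * (hS.eigenvalues rfl i : ℂ)) := by
    rw [LinearMap.trace_eq_sum_inner _ b]
    refine Finset.sum_congr rfl fun i _ => ?_
    rw [ContinuousLinearMap.coe_coe, hXb, inner_smul_right, inner_self_eq_norm_sq_to_K]
    simp
  rw [h1, Complex.exp_sum, ← LinearMap.det_toMatrix b.toBasis]
  have : LinearMap.toMatrix b.toBasis b.toBasis ((exp X : E →L[ℂ] E) : E →ₗ[ℂ] E) =
      Matrix.diagonal fun i => Complex.exp (-Complex.I * (hS.eigenvalues rfl i : ℂ)) := by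
    ext i j
    rw [LinearMap.toMatrix_apply]
    simp only [OrthonormalBasis.coe_toBasis, ContinuousLinearMap.coe_coe, hE]
    rw [map_smul]
    simp only [Finsupp.smul_apply, OrthonormalBasis.coe_toBasis_repr_apply,
      OrthonormalBasis.repr_self, Matrix.diagonal_apply, smul_eq_mul]
    by_cases hij : i = j
    · subst hij; simp
    · simp [hij]
  rw [this, Matrix.det_diagonal]

instance instCompactUnitary : CompactSpace (unitary (E →L[ℂ] E)) := by
  have : ProperSpace (E →L[ℂ] E) := FiniteDimensional.proper ℂ _
  refine isCompact_iff_compactSpace (s := (unitary (E →L[ℂ] E) : Set (E →L[ℂ] E))).mp ?_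
  refine Metric.isCompact_of_isClosed_isBounded ?_ ?_
  · have : (unitary (E →L[ℂ] E) : Set (E →L[ℂ] E)) =
      {U | star U * U = 1} ∩ {U | U * star U = 1} := by
      ext; simp [Unitary.mem_iff]
    erw [this]
    exact (isClosed_eq (by fun_prop) (by fun_prop)).inter
      (isClosed_eq (by fun_prop) (by fun_prop))
  · refine (Metric.isBounded_closedBall (x := 0) (r := 1)).subset fun U hU => ?_
    simp only [Metric.mem_closedBall, dist_zero_right]
    rcases subsingleton_or_nontrivial E with h | h
    · have : U = 0 := Subsingleton.elim _ _
      simp [this]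
    · exact (CStarRing.norm_of_mem_unitary hU).le
end
end SphereCtl

namespace SphereCtl
open NormedSpace Filter Topology

section
variable {E : Type*} [NormedAddCommGroup E] [InnerProductSpace ℂ E] [FiniteDimensional ℂ E]

/-- Generators of the semigroup: exponentials for nonnegative times. -/
def gens (𝒳 : Set (E →L[ℂ] E)) : Set (unitary (E →L[ℂ] E)) :=
  {g | ∃ X ∈ 𝒳, ∃ t : ℝ, 0 ≤ t ∧ (g : E →L[ℂ] E) = exp (t • X)}

/-- The semigroup reached with piecewise constant controls. -/
noncomputable def Am (𝒳 : Set (E →L[ℂ] E)) : Submonoid (unitary (E →L[ℂ] E)) := Submonoid.closure (gens 𝒳)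

/-- The closed group generated. -/
noncomputable def Kg (𝒳 : Set (E →L[ℂ] E)) : Subgroup (unitary (E →L[ℂ] E)) :=
  (Subgroup.closure (gens 𝒳)).topologicalClosure

theorem coe_inv' (g : unitary (E →L[ℂ] E)) : ((g⁻¹ : unitary (E →L[ℂ] E)) : E →L[ℂ] E) = star (g : E →L[ℂ] E) := rfl

theorem closure_Am (𝒳 : Set (E →L[ℂ] E)) :
    closure (Am 𝒳 : Set (unitary (E →L[ℂ] E))) = Kg 𝒳 :=
  closure_submonoidClosure_eq_closure_subgroupClosure (gens 𝒳)

theorem Am_le_Kg (𝒳 : Set (E →L[ℂ] E)) {g : unitary (E →L[ℂ] E)} (hg : g ∈ Am 𝒳) : g ∈ Kg 𝒳 := by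
  have : g ∈ (Kg 𝒳 : Set (unitary (E →L[ℂ] E))) := by
    rw [← closure_Am]; exact subset_closure hg
  exact this

theorem isClosed_Kg (𝒳 : Set (E →L[ℂ] E)) :
    IsClosed (Kg 𝒳 : Set (unitary (E →L[ℂ] E))) :=
  Subgroup.isClosed_topologicalClosure _

theorem skew_smul {X : E →L[ℂ] E} (hX : star X = -X) (t : ℝ) : star (t • X) = -(t • X) := by
  rw [star_smul, hX]; simp

theorem exp_skew_mem {X : E →L[ℂ] E} (hX : star X = -X) : exp X ∈ unitary (E →L[ℂ] E) := by
  let _ : NormedAlgebra ℚ (E →L[ℂ] E) := NormedAlgebra.restrictScalars ℚ ℝ _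
  exact exp_mem_unitary_of_mem_skewAdjoint (skewAdjoint.mem_iff.mpr hX)

/-- Exponential of a skew operator as a unitary. -/
noncomputable def expU (X : E →L[ℂ] E) (hX : star X = -X) : unitary (E →L[ℂ] E) :=
  ⟨exp X, exp_skew_mem hX⟩

/-- The span of all conjugates of the generators. -/
noncomputable def PP (𝒳 : Set (E →L[ℂ] E)) : Submodule ℝ (E →L[ℂ] E) :=
  Submodule.span ℝ {Y | ∃ h ∈ Am 𝒳, ∃ X ∈ 𝒳, Y = star (h : E →L[ℂ] E) * X * h}

theorem isClosed_PP (𝒳 : Set (E →L[ℂ] E)) : IsClosed (PP 𝒳 : Set (E →L[ℂ] E)) := by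
  have : FiniteDimensional ℝ (E →L[ℂ] E) := FiniteDimensional.complexToReal _
  exact (PP 𝒳).closed_of_finiteDimensional

theorem conj_gen_mem (𝒳 : Set (E →L[ℂ] E)) {k : unitary (E →L[ℂ] E)} (hk : k ∈ Kg 𝒳)
    {X : E →L[ℂ] E} (hX : X ∈ 𝒳) : star (k : E →L[ℂ] E) * X * k ∈ PP 𝒳 := by
  have hc : IsClosed {k : unitary (E →L[ℂ] E) | star (k : E →L[ℂ] E) * X * k ∈ PP 𝒳} :=
    (isClosed_PP 𝒳).preimage (f := fun k : unitary (E →L[ℂ] E) => star (k : E →L[ℂ] E) * X * k)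
      (by fun_prop)
  have hs : (Am 𝒳 : Set (unitary (E →L[ℂ] E))) ⊆
      {k : unitary (E →L[ℂ] E) | star (k : E →L[ℂ] E) * X * k ∈ PP 𝒳} :=
    fun h hh => Submodule.subset_span ⟨h, hh, X, hX, rfl⟩
  have := closure_minimal hs hc
  rw [closure_Am] at this
  exact this hk

theorem conj_mem (𝒳 : Set (E →L[ℂ] E)) {g : unitary (E →L[ℂ] E)} (hg : g ∈ Kg 𝒳)
    {Y : E →L[ℂ] E} (hY : Y ∈ PP 𝒳) : star (g : E →L[ℂ] E) * Y * g ∈ PP 𝒳 := by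
  induction hY using Submodule.span_induction with
  | mem Y h =>
    obtain ⟨h, hh, X, hX, rfl⟩ := h
    have := conj_gen_mem 𝒳 ((Kg 𝒳).mul_mem (Am_le_Kg 𝒳 hh) hg) hX
    convert this using 1
    simp [mul_assoc]
  | zero => simp
  | add x y _ _ hx hy =>
    have := (PP 𝒳).add_mem hx hy
    rwa [mul_add, add_mul]
  | smul a x _ hx =>
    have := (PP 𝒳).smul_mem a hx
    rwa [mul_smul_comm, smul_mul_assoc]

theorem conj_mem' (𝒳 : Set (E →L[ℂ] E)) {g : unitary (E →L[ℂ] E)} (hg : g ∈ Kg 𝒳)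
    {Y : E →L[ℂ] E} (hY : Y ∈ PP 𝒳) : (g : E →L[ℂ] E) * Y * star (g : E →L[ℂ] E) ∈ PP 𝒳 := by
  have := conj_mem 𝒳 ((Kg 𝒳).inv_mem hg) hY
  rw [coe_inv'] at this
  simpa using this

theorem PP_skew {𝒳 : Set (E →L[ℂ] E)} (h𝒳 : ∀ X ∈ 𝒳, star X = -X)
    {Y : E →L[ℂ] E} (hY : Y ∈ PP 𝒳) : star Y = -Y := by
  induction hY using Submodule.span_induction with
  | mem Y h =>
    obtain ⟨h, hh, X, hX, rfl⟩ := h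
    simp [h𝒳 X hX, mul_assoc]
  | zero => simp
  | add x y _ _ hx hy => rw [star_add, hx, hy, neg_add]
  | smul a x _ hx => exact skew_smul hx a

/-- Lie algebra membership. -/
def inK (𝒳 : Set (E →L[ℂ] E)) (Z : E →L[ℂ] E) : Prop :=
  star Z = -Z ∧ ∀ t : ℝ, 0 ≤ t → ∃ g ∈ Kg 𝒳, (g : E →L[ℂ] E) = exp (t • Z)

theorem bracket_inK {𝒳 : Set (E →L[ℂ] E)} {Z Y : E →L[ℂ] E} (hZ : inK 𝒳 Z) (hY : Y ∈ PP 𝒳) :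
    Z * Y - Y * Z ∈ PP 𝒳 := by
  have h1 : HasDerivAt (fun t : ℝ => exp (t • Z) * Y * exp (t • (-Z))) (Z * Y - Y * Z) 0 := by
    have a := hasDerivAt_exp_smul_const (𝕂 := ℝ) Z 0
    have b := hasDerivAt_exp_smul_const (𝕂 := ℝ) (-Z) 0
    have c := (a.mul_const Y).mul b
    refine c.congr_deriv ?_
    simp [sub_eq_add_neg]
  have h2 := h1.tendsto_slope_zero_right
  refine (isClosed_PP 𝒳).mem_of_tendsto h2 ?_
  filter_upwards [self_mem_nhdsWithin] with t ht
  obtain ⟨g, hg, he⟩ := hZ.2 t (le_of_lt ht)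
  have hs : exp (t • (-Z)) = star (g : E →L[ℂ] E) := by
    rw [he, star_exp, star_smul, hZ.1]; simp
  refine (PP 𝒳).smul_mem _ ((PP 𝒳).sub_mem ?_ ?_)
  · rw [zero_add, hs, ← he]; exact conj_mem' 𝒳 hg hY
  · simpa using hY

theorem gen_mem_gens {𝒳 : Set (E →L[ℂ] E)} (h𝒳 : ∀ X ∈ 𝒳, star X = -X) {X : E →L[ℂ] E}
    (hX : X ∈ 𝒳) {t : ℝ} (ht : 0 ≤ t) : expU (t • X) (skew_smul (h𝒳 X hX) t) ∈ Am 𝒳 :=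
  Submonoid.subset_closure ⟨X, hX, t, ht, rfl⟩

theorem bracket_PP {𝒳 : Set (E →L[ℂ] E)} (h𝒳 : ∀ X ∈ 𝒳, star X = -X) {Z Y : E →L[ℂ] E}
    (hZ : Z ∈ PP 𝒳) (hY : Y ∈ PP 𝒳) : Z * Y - Y * Z ∈ PP 𝒳 := by
  induction hZ using Submodule.span_induction with
  | mem Z h =>
    obtain ⟨h, hh, X, hX, rfl⟩ := h
    refine bracket_inK ⟨?_, fun t ht => ?_⟩ hY
    · simp [h𝒳 X hX, mul_assoc]
    · refine ⟨h⁻¹ * expU (t • X) (skew_smul (h𝒳 X hX) t) * h, (Kg 𝒳).mul_mem ((Kg 𝒳).mul_mem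
        ((Kg 𝒳).inv_mem (Am_le_Kg 𝒳 hh)) (Am_le_Kg 𝒳 (gen_mem_gens h𝒳 hX ht)))
          (Am_le_Kg 𝒳 hh), ?_⟩
      let _ : NormedAlgebra ℚ (E →L[ℂ] E) := NormedAlgebra.restrictScalars ℚ ℝ _
      have := exp_units_conj' (Unitary.toUnits h) (t • X)
      simp only [Unitary.val_toUnits_apply, Unitary.val_inv_toUnits_apply] at this
      simp only [Submonoid.coe_mul, expU, coe_inv'] at this ⊢
      rw [← this]
      congr 1
      simp [mul_assoc]
  | zero => simp
  | add x z _ _ hx hz =>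
    have := (PP 𝒳).add_mem hx hz
    convert this using 1
    noncomm_ring
  | smul a x _ hx =>
    have := (PP 𝒳).smul_mem a hx
    rwa [smul_sub, ← smul_mul_assoc, ← mul_smul_comm] at this

/-- Transitivity hypothesis. -/
def Trans (𝒳 : Set (E →L[ℂ] E)) : Prop :=
  ∀ ψ φ : E, ‖ψ‖ = 1 → ‖φ‖ = 1 → ∃ g ∈ Kg 𝒳, (g : E →L[ℂ] E) ψ = φ

theorem X_mem_PP {𝒳 : Set (E →L[ℂ] E)} {X : E →L[ℂ] E} (hX : X ∈ 𝒳) : X ∈ PP 𝒳 :=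
  Submodule.subset_span ⟨1, (Am 𝒳).one_mem, X, hX, by simp⟩

theorem scalar_of_commute [Nontrivial E] {𝒳 : Set (E →L[ℂ] E)} (ht : Trans 𝒳) {C : E →L[ℂ] E}
    (hC : ∀ X ∈ PP 𝒳, C * X - X * C = 0) : ∃ c : ℂ, C = c • 1 := by
  have hK : ∀ g ∈ Kg 𝒳, C * g = (g : E →L[ℂ] E) * C := by
    have hA : (Am 𝒳 : Set (unitary (E →L[ℂ] E))) ⊆
        {g : unitary (E →L[ℂ] E) | C * g = (g : E →L[ℂ] E) * C} := by
      intro g hg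
      induction hg using Submonoid.closure_induction with
      | mem g h =>
        obtain ⟨X, hX, t, _, he⟩ := h
        have h0 : Commute C X := sub_eq_zero.mp (hC X (X_mem_PP hX))
        have h1 : Commute C (exp (t • X)) := (h0.smul_right t).exp_right
        simpa [he] using h1.eq
      | one => simp
      | mul x y _ _ hx hy =>
        simp only [Set.mem_ofPred_eq, Submonoid.coe_mul] at *
        rw [← mul_assoc, hx, mul_assoc, hy, mul_assoc]
    have := closure_minimal hA (isClosed_eq (by fun_prop) (by fun_prop))
    rw [closure_Am] at this
    exact fun g hg => this hg
  obtain ⟨c, hc⟩ := Module.End.exists_eigenvalue (C : E →ₗ[ℂ] E)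
  obtain ⟨v, hv⟩ := hc.exists_hasEigenvector
  have hv0 : v ≠ 0 := hv.2
  have hve : C v = c • v := hv.apply_eq_smul
  refine ⟨c, ?_⟩
  ext w
  by_cases hw : w = 0
  · simp [hw]
  have n1 : ‖((‖v‖⁻¹ : ℝ) : ℂ) • v‖ = 1 := by
    rw [norm_smul]; simp [hv0]
  have n2 : ‖((‖w‖⁻¹ : ℝ) : ℂ) • w‖ = 1 := by
    rw [norm_smul]; simp [hw]
  obtain ⟨g, hg, hgv⟩ := ht _ _ n1 n2
  have h1 : C (((‖w‖⁻¹ : ℝ) : ℂ) • w) = c • (((‖w‖⁻¹ : ℝ) : ℂ) • w) := by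
    rw [← hgv]
    have := DFunLike.congr_fun (hK g hg) (((‖v‖⁻¹ : ℝ) : ℂ) • v)
    simp only [mul_apply_eq_comp] at this
    rw [this, map_smul C, hve, smul_comm, map_smul]
  rw [map_smul, smul_comm] at h1
  have h2 : ((‖w‖⁻¹ : ℝ) : ℂ) ≠ 0 := by simpa using hw
  simpa using smul_right_injective E h2 h1

end
end SphereCtl

namespace SphereCtl
open NormedSpace Filter Topology

section
variable {E : Type*} [NormedAddCommGroup E] [InnerProductSpace ℂ E] [FiniteDimensional ℂ E]

/-- Complex trace of an operator. -/
noncomputable def tr (X : E →L[ℂ] E) : ℂ := LinearMap.trace ℂ E (X : E →ₗ[ℂ] E)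

theorem tr_add (X Y : E →L[ℂ] E) : tr (X + Y) = tr X + tr Y := by simp [tr]
theorem tr_sub (X Y : E →L[ℂ] E) : tr (X - Y) = tr X - tr Y := by simp [tr]
theorem tr_smul (a : ℂ) (X : E →L[ℂ] E) : tr (a • X) = a * tr X := by simp [tr]
theorem tr_rsmul (a : ℝ) (X : E →L[ℂ] E) : tr (a • X) = a * tr X := by
  have : a • X = (a : ℂ) • X := by ext; simp
  rw [this, tr_smul]
theorem tr_comm (X Y : E →L[ℂ] E) : tr (X * Y) = tr (Y * X) := by
  have := LinearMap.trace_mul_comm ℂ (X : E →ₗ[ℂ] E) (Y : E →ₗ[ℂ] E)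
  exact this

/-- The real trace form. -/
noncomputable def BB : LinearMap.BilinForm ℝ (E →L[ℂ] E) :=
  LinearMap.mk₂ ℝ (fun X Y => (tr (X * Y)).re)
    (by intro a b c; simp [add_mul, tr_add])
    (by intro r a b; simp [tr_rsmul])
    (by intro a b c; simp [mul_add, tr_add])
    (by intro r a b; simp [tr_rsmul])

theorem BB_apply (X Y : E →L[ℂ] E) : BB X Y = (tr (X * Y)).re := rfl

theorem BB_comm (X Y : E →L[ℂ] E) : BB X Y = BB Y X := by
  rw [BB_apply, BB_apply, tr_comm]

theorem BB_def {X : E →L[ℂ] E} (hX : star X = -X) (h : BB X X = 0) : X = 0 := by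
  set b := stdOrthonormalBasis ℂ E
  have h1 : BB X X = - ∑ i, ‖X (b i)‖ ^ 2 := by
    rw [BB_apply, tr, LinearMap.trace_eq_sum_inner _ b, Complex.re_sum, ← Finset.sum_neg_distrib]
    refine Finset.sum_congr rfl fun i _ => ?_
    have : inner ℂ (b i) (X (X (b i))) = inner ℂ (star X (b i)) (X (b i)) := by
      rw [ContinuousLinearMap.star_eq_adjoint, ContinuousLinearMap.adjoint_inner_left]
    simp only [ContinuousLinearMap.coe_coe, mul_apply_eq_comp]
    rw [this, hX, neg_apply, inner_neg_left, inner_self_eq_norm_sq_to_K]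
    simp [← Complex.ofReal_pow]
  rw [h1, neg_eq_zero, Finset.sum_eq_zero_iff_of_nonneg (fun i _ => by positivity)] at h
  have h2 : (X : E →ₗ[ℂ] E) = 0 := by
    refine b.toBasis.ext fun i => ?_
    have := h i (Finset.mem_univ i)
    simpa using this
  ext v
  exact DFunLike.congr_fun h2 v

theorem BB_inv (Z Y W : E →L[ℂ] E) : BB (Z * Y - Y * Z) W = BB Z (Y * W - W * Y) := by
  simp only [BB_apply, sub_mul, mul_sub, tr_sub]
  rw [tr_comm (Y * Z) W, ← mul_assoc, ← mul_assoc, tr_comm Z (W * Y)]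

theorem BB_decomp (W : Submodule ℝ (E →L[ℂ] E)) (hW : ∀ X ∈ W, star X = -X) (Z : E →L[ℂ] E) :
    ∃ p ∈ W, ∃ q, Z = p + q ∧ ∀ y ∈ W, BB q y = 0 := by
  have : FiniteDimensional ℝ (E →L[ℂ] E) := FiniteDimensional.complexToReal _
  have hr : (BB (E := E)).IsRefl := fun x y h => by rw [BB_comm]; exact h
  have hd : Disjoint W ((BB (E := E)).orthogonal W) := by
    rw [Submodule.disjoint_def]
    intro x hx hx'
    exact BB_def (hW x hx) (hx' x hx)
  have hc := (LinearMap.BilinForm.isCompl_orthogonal_iff_disjoint hr).mpr hd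
  have : Z ∈ W ⊔ (BB (E := E)).orthogonal W := by rw [hc.sup_eq_top]; trivial
  obtain ⟨p, hp, q, hq, h⟩ := Submodule.mem_sup.mp this
  exact ⟨p, hp, q, h.symm, fun y hy => by rw [BB_comm]; exact hq y hy⟩

theorem scalar_skew [Nontrivial E] {c : ℂ} (h : star (c • (1 : E →L[ℂ] E)) = -(c • 1)) : c.re = 0 := by
  rw [star_smul, star_one, ← neg_smul] at h
  have := smul_left_injective ℂ (one_ne_zero (α := E →L[ℂ] E)) h
  have h2 := congrArg Complex.re this
  simp at h2
  linarith

theorem det_Kg {𝒳 : Set (E →L[ℂ] E)} (h𝒳 : ∀ X ∈ 𝒳, star X = -X) (h0 : ∀ X ∈ 𝒳, tr X = 0)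
    {g : unitary (E →L[ℂ] E)} (hg : g ∈ Kg 𝒳) :
    LinearMap.det ((g : E →L[ℂ] E) : E →ₗ[ℂ] E) = 1 := by
  have hA : (Am 𝒳 : Set (unitary (E →L[ℂ] E))) ⊆
      {g : unitary (E →L[ℂ] E) | LinearMap.det ((g : E →L[ℂ] E) : E →ₗ[ℂ] E) = 1} := by
    intro g hg
    induction hg using Submonoid.closure_induction with
    | mem g h =>
      obtain ⟨X, hX, t, _, he⟩ := h
      have h1 := det_exp_skew (t • X) (skew_smul (h𝒳 X hX) t)
      have h2 : LinearMap.trace ℂ E ((t • X : E →L[ℂ] E) : E →ₗ[ℂ] E) = 0 := by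
        have := tr_rsmul t X
        rw [h0 X hX, mul_zero] at this
        exact this
      rw [h2, ← he, Complex.exp_zero] at h1
      exact h1
    | one => simp
    | mul x y _ _ hx hy =>
      simp only [Set.mem_ofPred_eq, Submonoid.coe_mul] at *
      have : (((x : E →L[ℂ] E) * (y : E →L[ℂ] E) : E →L[ℂ] E) : E →ₗ[ℂ] E) =
        ((x : E →L[ℂ] E) : E →ₗ[ℂ] E) * ((y : E →L[ℂ] E) : E →ₗ[ℂ] E) := rfl
      rw [this, map_mul, hx, hy, mul_one]
  have hcont : Continuous fun g : unitary (E →L[ℂ] E) =>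
      LinearMap.det ((g : E →L[ℂ] E) : E →ₗ[ℂ] E) :=
    (ContinuousLinearMap.continuous_det (𝕜 := ℂ) (E := E)).comp continuous_subtype_val
  have := closure_minimal hA (isClosed_eq hcont continuous_const)
  rw [closure_Am] at this
  exact this hg

theorem inK_tr_zero {𝒳 : Set (E →L[ℂ] E)} (h𝒳 : ∀ X ∈ 𝒳, star X = -X) (h0 : ∀ X ∈ 𝒳, tr X = 0)
    {Z : E →L[ℂ] E} (hZ : inK 𝒳 Z) : tr Z = 0 := by
  have h1 : ∀ t : ℝ, 0 ≤ t → Complex.exp (t * tr Z) = 1 := by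
    intro t ht
    obtain ⟨g, hg, he⟩ := hZ.2 t ht
    have h2 := det_exp_skew (t • Z) (skew_smul hZ.1 t)
    rw [← he, det_Kg h𝒳 h0 hg] at h2
    rw [← tr_rsmul]
    exact h2.symm
  have hd : HasDerivAt (fun t : ℝ => Complex.exp (t * tr Z)) (tr Z) 0 := by
    have := ((Complex.ofRealCLM.hasDerivAt (x := 0)).mul_const (tr Z)).cexp
    simpa using this
  have h3 := hd.tendsto_slope_zero_right
  refine tendsto_nhds_unique h3 (tendsto_const_nhds.congr' ?_)
  filter_upwards [self_mem_nhdsWithin] with t ht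
  rw [zero_add, h1 t (le_of_lt ht), h1 0 le_rfl]; simp

theorem inK_subset [Nontrivial E] {𝒳 : Set (E →L[ℂ] E)} (h𝒳 : ∀ X ∈ 𝒳, star X = -X)
    (ht : Trans 𝒳) {Z : E →L[ℂ] E} (hZ : inK 𝒳 Z) : Z ∈ PP 𝒳 := by
  obtain ⟨p, hp, q, rfl, hq⟩ := BB_decomp (PP 𝒳) (fun X hX => PP_skew h𝒳 hX) Z
  have hqc : ∀ Y ∈ PP 𝒳, q * Y - Y * q = 0 := by
    intro Y hY
    have h1 : q * Y - Y * q ∈ PP 𝒳 := by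
      have := (PP 𝒳).sub_mem (bracket_inK hZ hY) (bracket_PP h𝒳 hp hY)
      convert this using 1
      noncomm_ring
    refine BB_def (PP_skew h𝒳 h1) ?_
    rw [BB_inv]
    exact hq _ (bracket_PP h𝒳 hY h1)
  obtain ⟨c, rfl⟩ := scalar_of_commute ht hqc
  have hcs : c.re = 0 := by
    refine scalar_skew (E := E) ?_
    have h1 := hZ.1
    rw [star_add, PP_skew h𝒳 hp, neg_add] at h1
    exact add_left_cancel h1
  have tr1 : tr (1 : E →L[ℂ] E) ≠ 0 := by
    have : tr (1 : E →L[ℂ] E) = Module.finrank ℂ E := LinearMap.trace_one ℂ E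
    rw [this]
    exact_mod_cast Module.finrank_pos.ne'
  refine (PP 𝒳).add_mem hp ?_
  by_cases h0 : ∀ Y ∈ PP 𝒳, tr Y = 0
  · have h2 := inK_tr_zero h𝒳 (fun X hX => h0 X (X_mem_PP hX)) hZ
    rw [tr_add, h0 p hp, zero_add, tr_smul] at h2
    rcases mul_eq_zero.mp h2 with h | h
    · simp [h]
    · exact absurd h tr1
  · push Not at h0
    obtain ⟨p0, hp0, htr⟩ := h0
    set D : Submodule ℝ (E →L[ℂ] E) :=
      Submodule.span ℝ {W | ∃ Y ∈ PP 𝒳, ∃ Z ∈ PP 𝒳, W = Y * Z - Z * Y} with hD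
    have hDP : D ≤ PP 𝒳 := by
      refine Submodule.span_le.mpr ?_
      rintro _ ⟨Y, hY, Z, hZ, rfl⟩
      exact bracket_PP h𝒳 hY hZ
    have hDtr : ∀ d ∈ D, tr d = 0 := by
      intro d hd
      induction hd using Submodule.span_induction with
      | mem d h =>
        obtain ⟨Y, _, Z, _, rfl⟩ := h
        rw [tr_sub, tr_comm, sub_self]
      | zero => simp [tr]
      | add x y _ _ hx hy => rw [tr_add, hx, hy, add_zero]
      | smul a x _ hx => rw [tr_rsmul, hx, mul_zero]
    obtain ⟨d, hd, e, he, hde⟩ := BB_decomp D (fun X hX => PP_skew h𝒳 (hDP hX)) p0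
    have heP : e ∈ PP 𝒳 := by
      have : e = p0 - d := by rw [he]; abel
      rw [this]
      exact (PP 𝒳).sub_mem hp0 (hDP hd)
    have hec : ∀ Y ∈ PP 𝒳, e * Y - Y * e = 0 := by
      intro Y hY
      refine BB_def (PP_skew h𝒳 (bracket_PP h𝒳 heP hY)) ?_
      rw [BB_inv]
      exact hde _ (Submodule.subset_span ⟨Y, hY, _, bracket_PP h𝒳 heP hY, rfl⟩)
    obtain ⟨c', rfl⟩ := scalar_of_commute ht hec
    have hc's : c'.re = 0 := scalar_skew (E := E) (PP_skew h𝒳 heP)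
    have hc'0 : c' ≠ 0 := by
      rintro rfl
      rw [he, tr_add, hDtr d hd, tr_smul, zero_mul, add_zero] at htr
      exact htr rfl
    have him : c'.im ≠ 0 := fun h => hc'0 (Complex.ext hc's h)
    have : c • (1 : E →L[ℂ] E) = (c.im / c'.im : ℝ) • (c' • (1 : E →L[ℂ] E)) := by
      have h5 : c = ((c.im / c'.im : ℝ) : ℂ) * c' := by
        apply Complex.ext
        · simp [hcs, hc's]
        · simp [him]
      conv_lhs => rw [h5]
      ext v
      simp only [mul_smul, smul_apply]
      rw [Complex.coe_smul]
    rw [this]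
    exact (PP 𝒳).smul_mem _ heP

end
end SphereCtl

namespace SphereCtl
open NormedSpace Filter Topology

section
variable {E : Type*} [NormedAddCommGroup E] [InnerProductSpace ℂ E] [FiniteDimensional ℂ E]

theorem norm_unitary_le (g : unitary (E →L[ℂ] E)) : ‖(g : E →L[ℂ] E)‖ ≤ 1 := by
  rcases subsingleton_or_nontrivial E with h | h
  · have : (g : E →L[ℂ] E) = 0 := Subsingleton.elim _ _
    simp [this]
  · exact (CStarRing.norm_of_mem_unitary g.2).le

theorem pow_sub_pow_le (g h : unitary (E →L[ℂ] E)) (N : ℕ) :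
    ‖(g : E →L[ℂ] E) ^ N - (h : E →L[ℂ] E) ^ N‖ ≤ N * ‖(g : E →L[ℂ] E) - h‖ := by
  induction N with
  | zero => simp
  | succ N ih =>
    have h1 : (g : E →L[ℂ] E) ^ (N + 1) - (h : E →L[ℂ] E) ^ (N + 1) =
        (g : E →L[ℂ] E) ^ N * (g - h) + ((g : E →L[ℂ] E) ^ N - (h : E →L[ℂ] E) ^ N) * h := by
      rw [pow_succ, pow_succ]; noncomm_ring
    have h2 : ‖(g : E →L[ℂ] E) ^ N‖ ≤ 1 := by
      have := norm_unitary_le (g ^ N)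
      simpa using this
    rw [h1]
    calc _ ≤ _ := norm_add_le _ _
      _ ≤ ‖(g : E →L[ℂ] E) ^ N‖ * ‖(g : E →L[ℂ] E) - h‖ +
          ‖(g : E →L[ℂ] E) ^ N - (h : E →L[ℂ] E) ^ N‖ * ‖(h : E →L[ℂ] E)‖ :=
        add_le_add (norm_mul_le _ _) (norm_mul_le _ _)
      _ ≤ 1 * ‖(g : E →L[ℂ] E) - h‖ + (N * ‖(g : E →L[ℂ] E) - h‖) * 1 := by
        gcongr
        exact norm_unitary_le h
      _ = _ := by push_cast; ring

theorem tendsto_pow_exp {g : ℕ → unitary (E →L[ℂ] E)} {N : ℕ → ℕ} {W : E →L[ℂ] E}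
    (hW : star W = -W) (hN : Tendsto N atTop atTop)
    (hg : Tendsto (fun j => (N j : ℝ) • ((g j : E →L[ℂ] E) - 1)) atTop (𝓝 W)) :
    Tendsto (fun j => (g j : E →L[ℂ] E) ^ (N j)) atTop (𝓝 (exp W)) := by
  have hNr : Tendsto (fun j => (N j : ℝ)) atTop atTop := tendsto_natCast_atTop_atTop.comp hN
  have h1 : Tendsto (fun j => (N j : ℝ) • (exp ((N j : ℝ)⁻¹ • W) - 1)) atTop (𝓝 W) := by
    have hd : HasDerivAt (fun t : ℝ => exp (t • W)) W 0 := by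
      simpa using hasDerivAt_exp_smul_const (𝕂 := ℝ) W 0
    have h2 := hd.tendsto_slope_zero_right
    have h3 : Tendsto (fun j => (N j : ℝ)⁻¹) atTop (𝓝[>] 0) :=
      tendsto_inv_atTop_nhdsGT_zero.comp hNr
    have h4 := h2.comp h3
    simpa [Function.comp_def] using h4
  have h2 := (hg.sub h1).norm
  rw [sub_self, norm_zero] at h2
  rw [tendsto_iff_norm_sub_tendsto_zero]
  refine squeeze_zero' (Eventually.of_forall fun _ => norm_nonneg _) ?_ h2
  filter_upwards [hN.eventually_gt_atTop 0] with j hj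
  have hj' : (N j : ℝ) ≠ 0 := by exact_mod_cast hj.ne'
  have h5 : exp W = exp ((N j : ℝ)⁻¹ • W) ^ (N j) := by
    let _ : NormedAlgebra ℚ (E →L[ℂ] E) := NormedAlgebra.restrictScalars ℚ ℝ _
    rw [← exp_nsmul, ← Nat.cast_smul_eq_nsmul ℝ, smul_smul, mul_inv_cancel₀ hj', one_smul]
  rw [h5]
  refine (pow_sub_pow_le (g j) (expU ((N j : ℝ)⁻¹ • W) (skew_smul hW _)) (N j)).trans ?_
  rw [← smul_sub, norm_smul]
  simp [expU]

theorem limit_inK {𝒳 : Set (E →L[ℂ] E)} {g : ℕ → unitary (E →L[ℂ] E)} {r : ℕ → ℝ}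
    {Z : E →L[ℂ] E} (hgK : ∀ j, g j ∈ Kg 𝒳) (hr : ∀ᶠ j in atTop, 0 < r j)
    (hr0 : Tendsto r atTop (𝓝 0))
    (hg1 : Tendsto (fun j => (g j : E →L[ℂ] E) - 1) atTop (𝓝 0))
    (hg : Tendsto (fun j => (r j)⁻¹ • ((g j : E →L[ℂ] E) - 1)) atTop (𝓝 Z)) : inK 𝒳 Z := by
  have hZ : star Z = -Z := by
    have h1 := hg.add hg.star
    have h2 := (hg.star.mul hg1).neg
    rw [mul_zero, neg_zero] at h2
    have h3 := tendsto_nhds_unique (h1.congr fun j => ?_) h2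
    · exact eq_neg_of_add_eq_zero_right h3
    · have h4 : star (g j : E →L[ℂ] E) * g j = 1 := Unitary.coe_star_mul_self (g j)
      simp only [star_smul, star_sub, star_one, star_trivial, smul_mul_assoc, ← smul_add, ← smul_neg]
      congr 1
      rw [sub_mul, mul_sub, mul_sub, h4]
      noncomm_ring
  refine ⟨hZ, fun t ht => ?_⟩
  rcases ht.eq_or_lt with rfl | ht
  · exact ⟨1, (Kg 𝒳).one_mem, by simp⟩
  have hrg : Tendsto r atTop (𝓝[>] 0) := tendsto_nhdsWithin_iff.mpr ⟨hr0, hr⟩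
  have hinv : Tendsto (fun j => t * (r j)⁻¹) atTop atTop :=
    (tendsto_inv_nhdsGT_zero.comp hrg).const_mul_atTop ht
  set N : ℕ → ℕ := fun j => ⌊t * (r j)⁻¹⌋₊ with hNdef
  have hN : Tendsto N atTop atTop := tendsto_nat_floor_atTop.comp hinv
  have hNr : Tendsto (fun j => (N j : ℝ) * r j) atTop (𝓝 t) := by
    have h1 : Tendsto (fun j => t - r j) atTop (𝓝 t) := by simpa using hr0.const_sub t
    refine tendsto_of_tendsto_of_tendsto_of_le_of_le' h1 tendsto_const_nhds ?_ ?_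
    · filter_upwards [hr] with j hj
      have := Nat.lt_floor_add_one (t * (r j)⁻¹)
      have h2 : t * (r j)⁻¹ * r j = t := by field_simp
      have h3 : t * (r j)⁻¹ * r j ≤ ((N j : ℝ) + 1) * r j := by
        gcongr
      linarith
    · filter_upwards [hr] with j hj
      have := Nat.floor_le (a := t * (r j)⁻¹) (by positivity)
      have h2 : t * (r j)⁻¹ * r j = t := by field_simp
      have h3 : (N j : ℝ) * r j ≤ t * (r j)⁻¹ * r j := by
        gcongr
      linarith
  have hlim : Tendsto (fun j => (N j : ℝ) • ((g j : E →L[ℂ] E) - 1)) atTop (𝓝 (t • Z)) := by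
    refine (hNr.smul hg).congr' ?_
    filter_upwards [hr] with j hj
    rw [smul_smul, mul_assoc, mul_inv_cancel₀ hj.ne', mul_one]
  have := tendsto_pow_exp (skew_smul hZ t) hN hlim
  refine ⟨expU (t • Z) (skew_smul hZ t), ?_, rfl⟩
  have h6 : Tendsto (fun j => g j ^ N j) atTop (𝓝 (expU (t • Z) (skew_smul hZ t))) := by
    rw [tendsto_subtype_rng]
    simpa [expU] using this
  exact (isClosed_Kg 𝒳).mem_of_tendsto h6 (Eventually.of_forall fun j => (Kg 𝒳).pow_mem (hgK j) _)

theorem norm_curve {ψ v : E} (hψ : ‖ψ‖ = 1) (hv : ‖v‖ = 1) (ho : (inner ℂ ψ v).re = 0) (s : ℝ) :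
    ‖Real.cos s • ψ + Real.sin s • v‖ = 1 := by
  have h : ‖Real.cos s • ψ + Real.sin s • v‖ ^ 2 = 1 := by
    rw [@norm_add_sq ℂ, norm_smul, norm_smul, hψ, hv]
    have : RCLike.re (inner ℂ (Real.cos s • ψ) (Real.sin s • v)) = 0 := by
      rw [← Complex.coe_smul, ← Complex.coe_smul, inner_smul_left, inner_smul_right]
      simp [-Complex.ofReal_cos, -Complex.ofReal_sin, ho]
    rw [this]
    simp
  have := norm_nonneg (Real.cos s • ψ + Real.sin s • v)
  nlinarith

theorem tangent_unit [Nontrivial E] {𝒳 : Set (E →L[ℂ] E)} (h𝒳 : ∀ X ∈ 𝒳, star X = -X)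
    (ht : Trans 𝒳) {ψ v : E} (hψ : ‖ψ‖ = 1) (hv : ‖v‖ = 1) (ho : (inner ℂ ψ v).re = 0) :
    ∃ Y ∈ PP 𝒳, Y ψ = v := by
  set γ : ℝ → E := fun s => Real.cos s • ψ + Real.sin s • v with hγ
  have hγ0 : γ 0 = ψ := by simp [hγ]
  have hγd : HasDerivAt γ v 0 := by
    have := ((Real.hasDerivAt_cos 0).smul_const ψ).add ((Real.hasDerivAt_sin 0).smul_const v)
    have h2 : HasDerivAt γ _ 0 := this
    exact h2.congr_deriv (by simp)
  have hslope : Tendsto (fun s => s⁻¹ • (γ s - ψ)) (𝓝[>] 0) (𝓝 v) := by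
    have := hγd.tendsto_slope_zero_right
    simpa [hγ0] using this
  set s : ℕ → ℝ := fun j => 1 / ((j : ℝ) + 1) with hs
  have hspos : ∀ j, 0 < s j := fun j => by positivity
  have hs0 : Tendsto s atTop (𝓝[>] 0) :=
    tendsto_nhdsWithin_iff.mpr ⟨tendsto_one_div_add_atTop_nhds_zero_nat,
      Eventually.of_forall hspos⟩
  have hmin : ∀ j, ∃ g ∈ Kg 𝒳, (g : E →L[ℂ] E) ψ = γ (s j) ∧
      ∀ h ∈ Kg 𝒳, (h : E →L[ℂ] E) ψ = γ (s j) → ‖(g : E →L[ℂ] E) - 1‖ ≤ ‖(h : E →L[ℂ] E) - 1‖ := by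
    intro j
    have hc : IsCompact {g : unitary (E →L[ℂ] E) | g ∈ Kg 𝒳 ∧ (g : E →L[ℂ] E) ψ = γ (s j)} :=
      ((isClosed_Kg 𝒳).inter (isClosed_eq (by fun_prop) (by fun_prop))).isCompact
    have hne : {g : unitary (E →L[ℂ] E) | g ∈ Kg 𝒳 ∧ (g : E →L[ℂ] E) ψ = γ (s j)}.Nonempty := by
      obtain ⟨g, hg, hg'⟩ := ht ψ (γ (s j)) hψ (norm_curve hψ hv ho _)
      exact ⟨g, hg, hg'⟩
    obtain ⟨g, hg, hm⟩ := hc.exists_isMinOn hne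
      (f := fun g : unitary (E →L[ℂ] E) => ‖(g : E →L[ℂ] E) - 1‖) (by fun_prop)
    exact ⟨g, hg.1, hg.2, fun h hh hh' => hm ⟨hh, hh'⟩⟩
  choose g hgK hgψ hgmin using hmin
  obtain ⟨gi, φ1, hφ1, hl1⟩ := CompactSpace.tendsto_subseq g
  have hgiK : gi ∈ Kg 𝒳 := (isClosed_Kg 𝒳).mem_of_tendsto hl1 (Eventually.of_forall fun j => hgK _)
  have hγlim : Tendsto (fun j => γ (s j)) atTop (𝓝 ψ) := by
    have h1 : Tendsto s atTop (𝓝 0) := tendsto_nhds_of_tendsto_nhdsWithin hs0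
    have := hγd.continuousAt.tendsto.comp h1
    rwa [hγ0] at this
  have hev : Continuous fun k : unitary (E →L[ℂ] E) => (k : E →L[ℂ] E) ψ := by fun_prop
  have hgiψ : (gi : E →L[ℂ] E) ψ = ψ := by
    have h1 := (hev.tendsto gi).comp hl1
    refine tendsto_nhds_unique (h1.congr fun j => ?_) (hγlim.comp hφ1.tendsto_atTop)
    exact hgψ _
  have hgiψ' : ((gi⁻¹ : unitary (E →L[ℂ] E)) : E →L[ℂ] E) ψ = ψ := by
    conv_lhs => rw [← hgiψ]
    rw [← mul_apply_eq_comp, ← Submonoid.coe_mul]; simp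
  have hr1 : Tendsto (fun j => ‖(g (φ1 j) : E →L[ℂ] E) - 1‖) atTop (𝓝 0) := by
    have hc : Continuous fun k : unitary (E →L[ℂ] E) =>
      ‖((k * gi⁻¹ : unitary (E →L[ℂ] E)) : E →L[ℂ] E) - 1‖ := by fun_prop
    have h1 := (hc.tendsto gi).comp hl1
    simp only [mul_inv_cancel, OneMemClass.coe_one, sub_self, norm_zero] at h1
    refine squeeze_zero (fun _ => norm_nonneg _) (fun j => ?_) h1
    refine hgmin _ _ ((Kg 𝒳).mul_mem (hgK _) ((Kg 𝒳).inv_mem hgiK)) ?_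
    rw [Submonoid.coe_mul, mul_apply_eq_comp, hgiψ']
    exact hgψ _
  have : ProperSpace (E →L[ℂ] E) := FiniteDimensional.proper ℂ _
  obtain ⟨Z, -, φ2, hφ2, hl2⟩ := (isCompact_closedBall (0 : E →L[ℂ] E) 1).tendsto_subseq
    (x := fun j => ‖(g (φ1 j) : E →L[ℂ] E) - 1‖⁻¹ • ((g (φ1 j) : E →L[ℂ] E) - 1)) (by
      intro j
      rw [mem_closedBall_zero_iff, norm_smul, norm_inv, norm_norm]
      exact inv_mul_le_one)
  set G : ℕ → unitary (E →L[ℂ] E) := fun j => g (φ1 (φ2 j)) with hG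
  set S : ℕ → ℝ := fun j => s (φ1 (φ2 j)) with hS
  set R : ℕ → ℝ := fun j => ‖(G j : E →L[ℂ] E) - 1‖ with hR
  have hS0 : Tendsto S atTop (𝓝[>] 0) := hs0.comp (hφ1.tendsto_atTop.comp hφ2.tendsto_atTop)
  have hSpos : ∀ j, 0 < S j := fun j => hspos _
  have hR0 : Tendsto R atTop (𝓝 0) := hr1.comp hφ2.tendsto_atTop
  have hGl : Tendsto (fun j => (R j)⁻¹ • ((G j : E →L[ℂ] E) - 1)) atTop (𝓝 Z) := hl2
  have hGψ : ∀ j, (G j : E →L[ℂ] E) ψ = γ (S j) := fun j => hgψ _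
  have hsl : Tendsto (fun j => (S j)⁻¹ • (γ (S j) - ψ)) atTop (𝓝 v) := hslope.comp hS0
  have hv0 : v ≠ 0 := by rintro rfl; simp at hv
  have hRpos : ∀ᶠ j in atTop, 0 < R j := by
    filter_upwards [hsl.eventually_ne hv0] with j hj
    rw [hR]
    refine norm_pos_iff.mpr fun h => hj ?_
    rw [← hGψ, sub_eq_zero.mp h]
    simp
  have hZK : inK 𝒳 Z := by
    refine limit_inK (g := G) (r := R) (fun j => hgK _) hRpos hR0 ?_ hGl
    exact tendsto_zero_iff_norm_tendsto_zero.mpr hR0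
  have hRgt : Tendsto R atTop (𝓝[>] 0) := tendsto_nhdsWithin_iff.mpr ⟨hR0, hRpos⟩
  have hZψ : Z ψ ≠ 0 := by
    intro hz
    have hd : HasDerivAt (fun t : ℝ => exp (t • Z)) Z 0 := by
      simpa using hasDerivAt_exp_smul_const (𝕂 := ℝ) Z 0
    have h2 := (hd.tendsto_slope_zero_right).comp hRgt
    have h3 := (hGl.sub h2).norm
    rw [sub_self, norm_zero] at h3
    have h4 : ∀ᶠ j in atTop, (1 : ℝ) ≤ ‖(R j)⁻¹ • ((G j : E →L[ℂ] E) - 1) -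
        (R j)⁻¹ • (exp ((0 + R j) • Z) - exp ((0 : ℝ) • Z))‖ := by
      filter_upwards [hRpos] with j hj
      obtain ⟨h, hh, he⟩ := hZK.2 (R j) hj.le
      have hhψ : (h : E →L[ℂ] E) ψ = ψ := by
        rw [he, exp_eig (R j • Z) ψ 0 (by simp [hz])]; simp
      have hhψ' : ((h⁻¹ : unitary (E →L[ℂ] E)) : E →L[ℂ] E) ψ = ψ := by
        conv_lhs => rw [← hhψ]
        rw [← mul_apply_eq_comp, ← Submonoid.coe_mul]; simp
      have h5 : R j ≤ ‖((G j * h⁻¹ : unitary (E →L[ℂ] E)) : E →L[ℂ] E) - 1‖ := by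
        refine hgmin _ _ ((Kg 𝒳).mul_mem (hgK _) ((Kg 𝒳).inv_mem hh)) ?_
        rw [Submonoid.coe_mul, mul_apply_eq_comp, hhψ', hgψ]
      have h6 : ((G j * h⁻¹ : unitary (E →L[ℂ] E)) : E →L[ℂ] E) - 1 =
          ((G j : E →L[ℂ] E) - h) * (h⁻¹ : unitary (E →L[ℂ] E)) := by
        rw [sub_mul, ← Submonoid.coe_mul, ← Submonoid.coe_mul]; simp
      have h7 : R j ≤ ‖(G j : E →L[ℂ] E) - h‖ := by
        rw [h6] at h5
        refine h5.trans ((norm_mul_le _ _).trans ?_)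
        exact mul_le_of_le_one_right (norm_nonneg _) (norm_unitary_le _)
      rw [← smul_sub, norm_smul, zero_add, zero_smul, exp_zero, ← he, sub_sub_sub_cancel_right,
        norm_inv, Real.norm_of_nonneg hj.le]
      rw [le_inv_mul_iff₀ hj, mul_one]
      exact h7
    have := ge_of_tendsto h3 h4
    linarith
  have hGψl : Tendsto (fun j => (R j)⁻¹ • (γ (S j) - ψ)) atTop (𝓝 (Z ψ)) := by
    have hc : Continuous fun k : E →L[ℂ] E => k ψ := by fun_prop
    refine ((hc.tendsto Z).comp hGl).congr fun j => ?_
    simp [hGψ]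
  have hratio : Tendsto (fun j => ‖(S j)⁻¹ • (γ (S j) - ψ)‖ / ‖(R j)⁻¹ • (γ (S j) - ψ)‖) atTop
      (𝓝 (‖v‖ / ‖Z ψ‖)) := hsl.norm.div hGψl.norm (norm_ne_zero_iff.mpr hZψ)
  have hfin := hratio.smul hGψl
  have heq : v = (‖v‖ / ‖Z ψ‖) • Z ψ := by
    refine tendsto_nhds_unique (hsl.congr' ?_) hfin
    filter_upwards [hRpos, hGψl.eventually_ne hZψ] with j hj hne
    have hne' : γ (S j) - ψ ≠ 0 := fun h => hne (by rw [h, smul_zero])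
    rw [norm_smul, norm_smul, smul_smul]
    congr 1
    have := norm_pos_iff.mpr hne'
    rw [norm_inv, norm_inv, Real.norm_of_nonneg hj.le, Real.norm_of_nonneg (hSpos j).le]
    have := hSpos j
    field_simp
  refine ⟨(‖v‖ / ‖Z ψ‖) • Z, (PP 𝒳).smul_mem _ (inK_subset h𝒳 ht hZK), ?_⟩
  rw [smul_apply]
  exact heq.symm

theorem tangent [Nontrivial E] {𝒳 : Set (E →L[ℂ] E)} (h𝒳 : ∀ X ∈ 𝒳, star X = -X)
    (ht : Trans 𝒳) {ψ v : E} (hψ : ‖ψ‖ = 1) (ho : (inner ℂ ψ v).re = 0) :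
    ∃ Y ∈ PP 𝒳, Y ψ = v := by
  by_cases hv : v = 0
  · exact ⟨0, (PP 𝒳).zero_mem, by simp [hv]⟩
  have hn : ‖v‖ ≠ 0 := norm_ne_zero_iff.mpr hv
  obtain ⟨Y, hY, h⟩ := tangent_unit h𝒳 ht (v := ‖v‖⁻¹ • v) hψ (by simp [norm_smul, hn]) (by
    rw [← Complex.coe_smul, inner_smul_right, Complex.re_ofReal_mul, ho, mul_zero])
  refine ⟨‖v‖ • Y, (PP 𝒳).smul_mem _ hY, ?_⟩
  rw [smul_apply, h, smul_smul, mul_inv_cancel₀ hn, one_smul]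

end
end SphereCtl

namespace SphereCtl
open NormedSpace Filter Topology

section
variable {E : Type*} [NormedAddCommGroup E] [InnerProductSpace ℂ E] [FiniteDimensional ℂ E]

theorem unitary_inv_apply (g : unitary (E →L[ℂ] E)) (x : E) :
    ((g⁻¹ : unitary (E →L[ℂ] E)) : E →L[ℂ] E) ((g : E →L[ℂ] E) x) = x := by
  rw [← mul_apply_eq_comp, ← Submonoid.coe_mul]; simp

theorem unitary_apply_inv (g : unitary (E →L[ℂ] E)) (x : E) :
    (g : E →L[ℂ] E) (((g⁻¹ : unitary (E →L[ℂ] E)) : E →L[ℂ] E) x) = x := by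
  rw [← mul_apply_eq_comp, ← Submonoid.coe_mul]; simp

theorem norm_unitary_apply (g : unitary (E →L[ℂ] E)) (x : E) :
    ‖(g : E →L[ℂ] E) x‖ = ‖x‖ := by
  refine le_antisymm ?_ ?_
  · calc _ ≤ ‖(g : E →L[ℂ] E)‖ * ‖x‖ := ContinuousLinearMap.le_opNorm _ _
      _ ≤ 1 * ‖x‖ := by gcongr; exact norm_unitary_le g
      _ = _ := one_mul _
  · calc ‖x‖ = ‖((g⁻¹ : unitary (E →L[ℂ] E)) : E →L[ℂ] E) ((g : E →L[ℂ] E) x)‖ := by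
          rw [unitary_inv_apply]
      _ ≤ ‖((g⁻¹ : unitary (E →L[ℂ] E)) : E →L[ℂ] E)‖ * ‖(g : E →L[ℂ] E) x‖ :=
        ContinuousLinearMap.le_opNorm _ _
      _ ≤ 1 * ‖(g : E →L[ℂ] E) x‖ := by gcongr; exact norm_unitary_le _
      _ = _ := one_mul _

/-- Data of a smooth family of reachable points with derivative of rank at least `d`. -/
def HasRank (𝒳 : Set (E →L[ℂ] E)) (ψ : E) (d : ℕ) : Prop :=
  ∃ (V : Type) (_ : NormedAddCommGroup V) (_ : NormedSpace ℝ V) (_ : CompleteSpace V)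
    (f : V → E) (L : V →L[ℝ] E), HasStrictFDerivAt f L 0 ∧
    (∀ᶠ t in 𝓝 (0 : V), ∃ a ∈ Am 𝒳, f t = (a : E →L[ℂ] E) ψ) ∧
    d ≤ Module.finrank ℝ (LinearMap.range L.toLinearMap)

theorem rank_step {𝒳 : Set (E →L[ℂ] E)} (h𝒳 : ∀ X ∈ 𝒳, star X = -X)
    {ψ : E} {V : Type} [NormedAddCommGroup V] [NormedSpace ℝ V] [CompleteSpace V]
    {f : V → E} {L : V →L[ℝ] E} (hf : HasStrictFDerivAt f L 0)
    (hr : ∀ᶠ t in 𝓝 (0 : V), ∃ a ∈ Am 𝒳, f t = (a : E →L[ℂ] E) ψ)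
    {h : unitary (E →L[ℂ] E)} (hh : h ∈ Am 𝒳) {X : E →L[ℂ] E} (hX : X ∈ 𝒳)
    (hn : (star (h : E →L[ℂ] E) * X * h) (f 0) ∉ LinearMap.range L.toLinearMap) :
    HasRank 𝒳 ψ (Module.finrank ℝ (LinearMap.range L.toLinearMap) + 1) := by
  have hfd : FiniteDimensional ℝ E := FiniteDimensional.complexToReal _
  set y := (star (h : E →L[ℂ] E) * X * h) (f 0) with hy
  let B : (E →L[ℂ] E) →L[ℝ] (E →L[ℝ] E) := ContinuousLinearMap.restrictScalarsL ℂ E E ℝ ℝ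
  have hc : HasStrictFDerivAt (fun p : V × ℝ => exp ((1 + p.2) • X))
      ((ContinuousLinearMap.toSpanSingleton ℝ (exp ((1 : ℝ) • X) * X)).comp
        (ContinuousLinearMap.snd ℝ V ℝ)) (0 : V × ℝ) := by
    have h1 : HasStrictDerivAt (fun u : ℝ => exp (u • X)) (exp ((1 : ℝ) • X) * X)
        ((fun p : V × ℝ => 1 + p.2) 0) := by
      simpa using hasStrictDerivAt_exp_smul_const (𝕂 := ℝ) X (1 : ℝ)
    have h2 : HasStrictFDerivAt (fun p : V × ℝ => 1 + p.2) (ContinuousLinearMap.snd ℝ V ℝ) 0 :=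
      (hasStrictFDerivAt_snd (𝕜 := ℝ) (p := (0 : V × ℝ))).const_add 1
    exact h1.hasStrictFDerivAt.comp (0 : V × ℝ) h2
  have hg : HasStrictFDerivAt (fun p : V × ℝ => B h (f p.1))
      (((B h).comp L).comp (ContinuousLinearMap.fst ℝ V ℝ)) (0 : V × ℝ) := by
    have h1 : HasStrictFDerivAt f L ((fun p : V × ℝ => p.1) 0) := hf
    have := h1.comp (0 : V × ℝ) (hasStrictFDerivAt_fst (𝕜 := ℝ) (p := (0 : V × ℝ)))
    exact (B h).hasStrictFDerivAt.comp (0 : V × ℝ) this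
  have hF := (B.hasStrictFDerivAt.comp (0 : V × ℝ) hc).clm_apply hg
  obtain ⟨L', hLe, hF'⟩ : ∃ L' : V × ℝ →L[ℝ] E,
      (∀ v t, L' (v, t) = exp ((1 : ℝ) • X) ((h : E →L[ℂ] E) (L v)) +
        t • exp ((1 : ℝ) • X) (X ((h : E →L[ℂ] E) (f 0)))) ∧
      HasStrictFDerivAt (fun p : V × ℝ => exp ((1 + p.2) • X) ((h : E →L[ℂ] E) (f p.1))) L' 0 := by
    refine ⟨_, ?_, hF⟩
    intro v t
    simp [B]
  refine ⟨V × ℝ, inferInstance, inferInstance, inferInstance, _, L', hF', ?_, ?_⟩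
  · have h1 : ∀ᶠ p in 𝓝 (0 : V × ℝ), ∃ a ∈ Am 𝒳, f p.1 = (a : E →L[ℂ] E) ψ :=
      (continuous_fst.tendsto' (0 : V × ℝ) 0 rfl).eventually hr
    have h2 : ∀ᶠ p in 𝓝 (0 : V × ℝ), 0 < 1 + p.2 := by
      have hcont : Continuous fun p : V × ℝ => 1 + p.2 := by fun_prop
      exact (hcont.tendsto' (0 : V × ℝ) 1 (by simp)).eventually (lt_mem_nhds one_pos)
    filter_upwards [h1, h2] with p ⟨a, ha, hap⟩ hp
    refine ⟨expU ((1 + p.2) • X) (skew_smul (h𝒳 X hX) _) * (h * a),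
      (Am 𝒳).mul_mem (gen_mem_gens h𝒳 hX hp.le) ((Am 𝒳).mul_mem hh ha), ?_⟩
    show exp ((1 + p.2) • X) ((h : E →L[ℂ] E) (f p.1)) = _
    rw [hap, Submonoid.coe_mul, Submonoid.coe_mul]
    rfl
  · let e : unitary (E →L[ℂ] E) := expU ((1 : ℝ) • X) (skew_smul (h𝒳 X hX) _)
    let M : E →ₗ[ℝ] E := (B ((e * h : unitary (E →L[ℂ] E)) : E →L[ℂ] E)).toLinearMap
    have hMi : Function.Injective M := by
      intro x x' hxx
      have := congrArg (((e * h)⁻¹ : unitary (E →L[ℂ] E)) : E →L[ℂ] E) hxx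
      have h1 := unitary_inv_apply (e * h) x
      have h2 := unitary_inv_apply (e * h) x'
      rw [← h1, ← h2]; exact this
    have hL' : ∀ v : V, ∀ t : ℝ, L' (v, t) = M (L v + t • y) := by
      intro v t
      have h5 : (h : E →L[ℂ] E) y = X ((h : E →L[ℂ] E) (f 0)) :=
        unitary_apply_inv h (X ((h : E →L[ℂ] E) (f 0)))
      rw [hLe, ← h5, map_add, map_smul]
      rfl
    have hle : (LinearMap.range L.toLinearMap ⊔ Submodule.span ℝ {y}).map M ≤
        LinearMap.range L'.toLinearMap := by
      rintro _ ⟨w, hw, rfl⟩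
      obtain ⟨_, ⟨v, rfl⟩, b, hb, rfl⟩ := Submodule.mem_sup.mp hw
      obtain ⟨t, rfl⟩ := Submodule.mem_span_singleton.mp hb
      exact ⟨(v, t), hL' v t⟩
    have hlt : LinearMap.range L.toLinearMap < LinearMap.range L.toLinearMap ⊔ Submodule.span ℝ {y} := by
      refine lt_of_le_of_ne le_sup_left fun heq => hn ?_
      rw [heq]
      exact Submodule.mem_sup_right (Submodule.mem_span_singleton_self y)
    have h1 := Submodule.finrank_lt_finrank_of_lt hlt
    have h2 := Submodule.finrank_mono hle
    rw [← (Submodule.equivMapOfInjective M hMi _).finrank_eq] at h2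
    omega

theorem exists_full [Nontrivial E] {𝒳 : Set (E →L[ℂ] E)} (h𝒳 : ∀ X ∈ 𝒳, star X = -X)
    (ht : Trans 𝒳) {ψ : E} (hψ : ‖ψ‖ = 1) :
    ∃ (V : Type) (_ : NormedAddCommGroup V) (_ : NormedSpace ℝ V) (_ : CompleteSpace V)
    (f : V → E) (L : V →L[ℝ] E), HasStrictFDerivAt f L 0 ∧
    (∀ᶠ t in 𝓝 (0 : V), ∃ a ∈ Am 𝒳, f t = (a : E →L[ℂ] E) ψ) ∧
    ∀ v : E, (inner ℂ (f 0) v).re = 0 → v ∈ LinearMap.range L.toLinearMap := by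
  have hfd : FiniteDimensional ℝ E := FiniteDimensional.complexToReal _
  by_contra hcon
  have key : ∀ d, HasRank 𝒳 ψ d := by
    intro d
    induction d with
    | zero =>
      refine ⟨ℝ, inferInstance, inferInstance, inferInstance, fun _ => ψ, 0,
        hasStrictFDerivAt_const _ _, Eventually.of_forall fun t => ⟨1, (Am 𝒳).one_mem, ?_⟩, Nat.zero_le _⟩
      simp
    | succ d ih =>
      obtain ⟨V, i1, i2, i3, f, L, hf, hr, hd⟩ := ih
      have h1 : ∃ v : E, (inner ℂ (f 0) v).re = 0 ∧ v ∉ LinearMap.range L.toLinearMap := by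
        by_contra h2
        push Not at h2
        exact hcon ⟨V, i1, i2, i3, f, L, hf, hr, h2⟩
      obtain ⟨v, hv, hvn⟩ := h1
      have hf0 : ‖f 0‖ = 1 := by
        obtain ⟨a, -, ha⟩ := hr.self_of_nhds
        rw [ha, norm_unitary_apply, hψ]
      obtain ⟨Y, hY, hYv⟩ := tangent h𝒳 ht hf0 hv
      have h3 : ∃ h ∈ Am 𝒳, ∃ X ∈ 𝒳, (star (h : E →L[ℂ] E) * X * h) (f 0) ∉ LinearMap.range L.toLinearMap := by
        by_contra h4
        push Not at h4
        apply hvn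
        rw [← hYv]
        refine Submodule.span_induction (p := fun Y _ => Y (f 0) ∈ LinearMap.range L.toLinearMap)
          ?_ ?_ ?_ ?_ hY
        · rintro _ ⟨h, hh, X, hX, rfl⟩
          exact h4 h hh X hX
        · exact Submodule.zero_mem _
        · intro x y _ _ hx hy
          exact Submodule.add_mem _ hx hy
        · intro c x _ hx
          exact Submodule.smul_mem _ c hx
      obtain ⟨h, hh, X, hX, hn⟩ := h3
      obtain ⟨V', j1, j2, j3, f', L', a1, a2, a3⟩ := rank_step h𝒳 hf hr hh hX hn
      exact ⟨V', j1, j2, j3, f', L', a1, a2, by omega⟩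
  obtain ⟨V, i1, i2, i3, f, L, hf, hr, hd⟩ := key (Module.finrank ℝ E + 1)
  have := Submodule.finrank_le (LinearMap.range L.toLinearMap)
  omega

theorem local_reach [Nontrivial E] {𝒳 : Set (E →L[ℂ] E)} (h𝒳 : ∀ X ∈ 𝒳, star X = -X)
    (ht : Trans 𝒳) {ψ : E} (hψ : ‖ψ‖ = 1) :
    ∃ f0 : E, ‖f0‖ = 1 ∧ ∀ᶠ x in 𝓝 f0, ‖x‖ = 1 → ∃ a ∈ Am 𝒳, x = (a : E →L[ℂ] E) ψ := by
  obtain ⟨V, i1, i2, i3, f, L, hf, hr, hfull⟩ := exists_full h𝒳 ht hψ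
  have hf0 : ‖f 0‖ = 1 := by
    obtain ⟨a, -, ha⟩ := hr.self_of_nhds
    rw [ha, norm_unitary_apply, hψ]
  refine ⟨f 0, hf0, ?_⟩
  have hfd : FiniteDimensional ℝ E := FiniteDimensional.complexToReal _
  have : CompleteSpace E := FiniteDimensional.complete ℝ E
  have h2 : HasStrictFDerivAt (fun p : V × ℝ => 1 + p.2) (ContinuousLinearMap.snd ℝ V ℝ) 0 :=
      (hasStrictFDerivAt_snd (𝕜 := ℝ) (p := (0 : V × ℝ))).const_add 1
  have h3 : HasStrictFDerivAt (fun p : V × ℝ => f p.1)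
      (L.comp (ContinuousLinearMap.fst ℝ V ℝ)) (0 : V × ℝ) := by
    have h1 : HasStrictFDerivAt f L ((fun p : V × ℝ => p.1) 0) := hf
    exact h1.comp (0 : V × ℝ) (hasStrictFDerivAt_fst (𝕜 := ℝ) (p := (0 : V × ℝ)))
  have hF := h2.smul h3
  set L' : V × ℝ →L[ℝ] E := _
  have hF : HasStrictFDerivAt (fun p : V × ℝ => (1 + p.2) • f p.1) L' 0 := hF
  have hL' : ∀ v t, L' (v, t) = L v + t • f 0 := by
    intro v t
    simp [L']
  have hsurj : LinearMap.range L'.toLinearMap = ⊤ := by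
    rw [eq_top_iff]
    intro w _
    set c := (inner ℂ (f 0) w).re with hc
    have : (inner ℂ (f 0) (w - c • f 0)).re = 0 := by
      rw [inner_sub_right, ← Complex.coe_smul, inner_smul_right, inner_self_eq_norm_sq_to_K, hf0]
      simp [hc]
    obtain ⟨v, hv⟩ := hfull _ this
    refine ⟨(v, c), ?_⟩
    have hv' : L v = w - c • f 0 := hv
    show L' (v, c) = w
    rw [hL', hv']; abel
  have hmap := hF.map_nhds_eq_of_surj hsurj
  have hev : ∀ᶠ p in 𝓝 (0 : V × ℝ), ‖(1 + p.2) • f p.1‖ = 1 →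
      ∃ a ∈ Am 𝒳, (1 + p.2) • f p.1 = (a : E →L[ℂ] E) ψ := by
    have h1 : ∀ᶠ p in 𝓝 (0 : V × ℝ), ∃ a ∈ Am 𝒳, f p.1 = (a : E →L[ℂ] E) ψ :=
      (continuous_fst.tendsto' (0 : V × ℝ) 0 rfl).eventually hr
    have h2 : ∀ᶠ p in 𝓝 (0 : V × ℝ), 0 < 1 + p.2 := by
      have hcont : Continuous fun p : V × ℝ => 1 + p.2 := by fun_prop
      exact (hcont.tendsto' (0 : V × ℝ) 1 (by simp)).eventually (lt_mem_nhds one_pos)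
    filter_upwards [h1, h2] with p ⟨a, ha, hap⟩ hp hnorm
    refine ⟨a, ha, ?_⟩
    rw [norm_smul, hap, norm_unitary_apply, hψ, mul_one, Real.norm_of_nonneg hp.le] at hnorm
    rw [hnorm, one_smul, hap]
  have := (Filter.eventually_map (m := fun p : V × ℝ => (1 + p.2) • f p.1)
    (P := fun x => ‖x‖ = 1 → ∃ a ∈ Am 𝒳, x = (a : E →L[ℂ] E) ψ)).mpr hev
  rw [hmap] at this
  simpa using this

theorem exact_reach [Nontrivial E] {𝒳 : Set (E →L[ℂ] E)} (h𝒳 : ∀ X ∈ 𝒳, star X = -X)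
    (ht : Trans 𝒳) {ψ φ : E} (hψ : ‖ψ‖ = 1) (hφ : ‖φ‖ = 1) :
    ∃ a ∈ Am 𝒳, (a : E →L[ℂ] E) ψ = φ := by
  obtain ⟨f0, hf0, hev⟩ := local_reach h𝒳 ht hψ
  obtain ⟨k, hk, hkf⟩ := ht f0 φ hf0 hφ
  have hk' : k ∈ closure (Am 𝒳 : Set (unitary (E →L[ℂ] E))) := by
    rw [closure_Am]; exact hk
  have hc : Continuous fun g : unitary (E →L[ℂ] E) =>
      ((g⁻¹ : unitary (E →L[ℂ] E)) : E →L[ℂ] E) φ := by fun_prop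
  have h0 : ((k⁻¹ : unitary (E →L[ℂ] E)) : E →L[ℂ] E) φ = f0 := by
    rw [← hkf, unitary_inv_apply]
  have hev2 := (hc.tendsto' k f0 h0).eventually hev
  obtain ⟨a, ha, haA⟩ := (mem_closure_iff_frequently.mp hk').and_eventually hev2 |>.exists
  obtain ⟨b, hb, hbe⟩ := haA (by rw [norm_unitary_apply, hφ])
  refine ⟨a * b, (Am 𝒳).mul_mem ha hb, ?_⟩
  rw [Submonoid.coe_mul, mul_apply_eq_comp, ← hbe, unitary_apply_inv]

end
end SphereCtl

namespace SphereCtl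
open NormedSpace Filter Topology MeasureTheory

section
variable {E : Type*} [NormedAddCommGroup E] [InnerProductSpace ℂ E] [FiniteDimensional ℂ E]

theorem expU_mem_Kg {𝒳 : Set (E →L[ℂ] E)} (h𝒳 : ∀ X ∈ 𝒳, star X = -X) {X : E →L[ℂ] E}
    (hX : X ∈ 𝒳) (s : ℝ) : expU (s • X) (skew_smul (h𝒳 X hX) s) ∈ Kg 𝒳 := by
  rcases le_total 0 s with hs | hs
  · exact Am_le_Kg 𝒳 (gen_mem_gens h𝒳 hX hs)
  · have h1 : expU (s • X) (skew_smul (h𝒳 X hX) s) =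
        (expU ((-s) • X) (skew_smul (h𝒳 X hX) (-s)))⁻¹ := by
      apply Subtype.ext
      rw [coe_inv']
      show exp (s • X) = star (exp ((-s) • X))
      rw [star_exp, skew_smul (h𝒳 X hX)]
      simp
    rw [h1]
    exact (Kg 𝒳).inv_mem (Am_le_Kg 𝒳 (gen_mem_gens h𝒳 hX (by linarith)))

/-- Orbit of a point under the closed group. -/
def orb (𝒳 : Set (E →L[ℂ] E)) (ψ : E) : Set E :=
  (fun g : unitary (E →L[ℂ] E) => (g : E →L[ℂ] E) ψ) '' (Kg 𝒳 : Set (unitary (E →L[ℂ] E)))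

theorem isClosed_orb (𝒳 : Set (E →L[ℂ] E)) (ψ : E) : IsClosed (orb 𝒳 ψ) :=
  ((isClosed_Kg 𝒳).isCompact.image (by fun_prop)).isClosed

theorem self_mem_orb (𝒳 : Set (E →L[ℂ] E)) (ψ : E) : ψ ∈ orb 𝒳 ψ :=
  ⟨1, (Kg 𝒳).one_mem, by simp⟩

theorem infDist_orb_le (𝒳 : Set (E →L[ℂ] E)) (ψ x : E) {g : unitary (E →L[ℂ] E)} (hg : g ∈ Kg 𝒳) :
    Metric.infDist ((g : E →L[ℂ] E) x) (orb 𝒳 ψ) ≤ Metric.infDist x (orb 𝒳 ψ) := by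
  refine (Metric.le_infDist ⟨ψ, self_mem_orb 𝒳 ψ⟩).mpr ?_
  rintro _ ⟨k, hk, rfl⟩
  have h1 : (g : E →L[ℂ] E) ((k : E →L[ℂ] E) ψ) ∈ orb 𝒳 ψ := by
    refine ⟨g * k, (Kg 𝒳).mul_mem hg hk, ?_⟩
    simp
  refine (Metric.infDist_le_dist_of_mem h1).trans (le_of_eq ?_)
  rw [dist_eq_norm, dist_eq_norm, ← map_sub, norm_unitary_apply]

theorem infDist_orb (𝒳 : Set (E →L[ℂ] E)) (ψ x : E) {g : unitary (E →L[ℂ] E)} (hg : g ∈ Kg 𝒳) :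
    Metric.infDist ((g : E →L[ℂ] E) x) (orb 𝒳 ψ) = Metric.infDist x (orb 𝒳 ψ) := by
  refine le_antisymm (infDist_orb_le 𝒳 ψ x hg) ?_
  have := infDist_orb_le 𝒳 ψ ((g : E →L[ℂ] E) x) ((Kg 𝒳).inv_mem hg)
  rwa [unitary_inv_apply] at this

theorem hasDerivAt_exp_apply (X : E →L[ℂ] E) (x : E) (t0 t : ℝ) :
    HasDerivAt (fun s : ℝ => exp ((s - t0) • X) x) (X (exp ((t - t0) • X) x)) t := by
  have h1 : HasDerivAt (fun u : ℝ => exp (u • X)) (X * exp ((t - t0) • X)) (t - t0) :=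
    hasDerivAt_exp_smul_const' (𝕂 := ℝ) X (t - t0)
  have h2 : HasDerivAt (fun s : ℝ => exp ((s - t0) • X)) (X * exp ((t - t0) • X)) t := by
    simpa using h1.comp_sub_const t t0
  let B : (E →L[ℂ] E) →L[ℝ] E := (ContinuousLinearMap.apply ℂ E x).restrictScalars ℝ
  exact B.hasFDerivAt.comp_hasDerivAt t h2

theorem hasDerivAt_infDist {𝒳 : Set (E →L[ℂ] E)} (h𝒳 : ∀ X ∈ 𝒳, star X = -X) {X : E →L[ℂ] E}
    (hX : X ∈ 𝒳) (ψ0 : E) {ψ : ℝ → E} {t0 : ℝ} (hd : HasDerivAt ψ (X (ψ t0)) t0) :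
    HasDerivAt (fun t => Metric.infDist (ψ t) (orb 𝒳 ψ0)) 0 t0 := by
  have h1 := hd.sub (hasDerivAt_exp_apply X (ψ t0) t0 t0)
  rw [hasDerivAt_iff_isLittleO] at h1 ⊢
  refine Asymptotics.IsBigO.trans_isLittleO (Asymptotics.IsBigO.of_bound 1 ?_) h1
  refine Eventually.of_forall fun t => ?_
  have h2 : Metric.infDist (ψ t0) (orb 𝒳 ψ0) =
      Metric.infDist (exp ((t - t0) • X) (ψ t0)) (orb 𝒳 ψ0) :=
    (infDist_orb 𝒳 ψ0 (ψ t0) (expU_mem_Kg h𝒳 hX (t - t0))).symm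
  have h3 : ∀ a b : E, |Metric.infDist a (orb 𝒳 ψ0) - Metric.infDist b (orb 𝒳 ψ0)| ≤ ‖a - b‖ := by
    intro a b
    have := (Metric.lipschitz_infDist_pt (orb 𝒳 ψ0)).dist_le_mul a b
    simpa [Real.dist_eq, dist_eq_norm] using this
  simp only [h2, smul_zero, sub_zero, one_mul, sub_self, zero_smul, exp_zero]
  have h4 := h3 (ψ t) (exp ((t - t0) • X) (ψ t0))
  simpa using h4

theorem absCont_of_dist_le {f : ℝ → ℝ} {g : ℝ → ℝ} {a b : ℝ}
    (hg : AbsolutelyContinuousOnInterval g a b)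
    (h : ∀ x ∈ Set.uIcc a b, ∀ y ∈ Set.uIcc a b, dist (f x) (f y) ≤ dist (g x) (g y)) :
    AbsolutelyContinuousOnInterval f a b := by
  rw [absolutelyContinuousOnInterval_iff] at hg ⊢
  intro ε hε
  obtain ⟨δ, hδ, H⟩ := hg ε hε
  refine ⟨δ, hδ, fun I hI hlt => lt_of_le_of_lt (Finset.sum_le_sum fun i hi => ?_) (H I hI hlt)⟩
  have := hI.1 i hi
  exact h _ this.1 _ this.2

theorem traj_mem_orb {𝒳 : Set (E →L[ℂ] E)} (h𝒳 : ∀ X ∈ 𝒳, star X = -X) {T : ℝ} (hT : 0 ≤ T)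
    {A : ℝ → E →L[ℂ] E} (hA : ∀ t ∈ Set.Icc 0 T, A t ∈ 𝒳) {ψ : ℝ → E}
    (hint : IntervalIntegrable (fun s => A s (ψ s)) volume 0 T)
    (hψ : ∀ t ∈ Set.Icc 0 T, ψ t = ψ 0 + ∫ s in (0 : ℝ)..t, A s (ψ s)) :
    ψ T ∈ orb 𝒳 (ψ 0) := by
  have : CompleteSpace E := FiniteDimensional.complete ℂ E
  set p : ℝ → ℝ := fun t => Metric.infDist (ψ t) (orb 𝒳 (ψ 0)) with hp
  have hac : AbsolutelyContinuousOnInterval p 0 T := by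
    refine absCont_of_dist_le
      (hint.norm.absolutelyContinuousOnInterval_intervalIntegral (c := 0) Set.left_mem_uIcc) ?_
    intro x hx y hy
    have hix := hint.mono_set (Set.uIcc_subset_uIcc_left hx)
    have hiy := hint.mono_set (Set.uIcc_subset_uIcc_left hy)
    have h1 : dist (p x) (p y) ≤ dist (ψ x) (ψ y) := by
      simpa using (Metric.lipschitz_infDist_pt (orb 𝒳 (ψ 0))).dist_le_mul (ψ x) (ψ y)
    refine h1.trans ?_
    rw [Set.uIcc_of_le hT] at hx hy
    rw [hψ x hx, hψ y hy, dist_add_left, dist_eq_norm, Real.dist_eq,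
      intervalIntegral.integral_interval_sub_left hix hiy,
      intervalIntegral.integral_interval_sub_left hix.norm hiy.norm]
    exact intervalIntegral.norm_integral_le_abs_integral_norm
  have hder : ∀ᵐ x, x ∈ Set.uIcc 0 T → HasDerivAt p 0 x := by
    have h₁ : ∀ᵐ x : ℝ, x ≠ 0 := by simp [ae_iff, measure_singleton]
    have h₂ : ∀ᵐ x : ℝ, x ≠ T := by simp [ae_iff, measure_singleton]
    filter_upwards [hint.ae_hasDerivAt_integral, h₁, h₂] with x hx hx0 hxT hxm
    have hd := (hx hxm 0 Set.left_mem_uIcc).const_add (ψ 0)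
    rw [Set.uIcc_of_le hT] at hxm
    refine hasDerivAt_infDist h𝒳 (hA x hxm) (ψ 0) (hd.congr_of_eventuallyEq ?_)
    have : Set.Ioo 0 T ∈ 𝓝 x :=
      Ioo_mem_nhds (lt_of_le_of_ne hxm.1 hx0.symm) (lt_of_le_of_ne hxm.2 hxT)
    filter_upwards [this] with t ht
    exact hψ t ⟨ht.1.le, ht.2.le⟩
  obtain ⟨C, hC⟩ := hac.const_of_ae_hasDerivAt_zero hder
  have h0 : p 0 = 0 := Metric.infDist_zero_of_mem (self_mem_orb 𝒳 (ψ 0))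
  have h1 : p T = 0 := by
    rw [hC T Set.right_mem_uIcc, ← hC 0 Set.left_mem_uIcc, h0]
  exact ((isClosed_orb 𝒳 (ψ 0)).mem_iff_infDist_zero ⟨_, self_mem_orb 𝒳 (ψ 0)⟩).mpr h1

theorem append_traj {T τ : ℝ} (hT : 0 ≤ T) (hτ : 0 ≤ τ) {A : ℝ → E →L[ℂ] E} {ψ : ℝ → E}
    (hint : IntervalIntegrable (fun s => A s (ψ s)) volume 0 T)
    (hψ : ∀ t ∈ Set.Icc 0 T, ψ t = ψ 0 + ∫ s in (0 : ℝ)..t, A s (ψ s)) (X : E →L[ℂ] E)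
    {A' : ℝ → E →L[ℂ] E} {ψ' : ℝ → E}
    (hA' : ∀ s, A' s = if s ≤ T then A s else X)
    (hψ' : ∀ s, ψ' s = if s ≤ T then ψ s else exp ((s - T) • X) (ψ T)) :
    IntervalIntegrable (fun s => A' s (ψ' s)) volume 0 (T + τ) ∧
    ∀ t ∈ Set.Icc 0 (T + τ), ψ' t = ψ' 0 + ∫ s in (0 : ℝ)..t, A' s (ψ' s) := by
  have : CompleteSpace E := FiniteDimensional.complete ℂ E
  have e1 : ∀ t, t ≤ T → Set.EqOn (fun s => A s (ψ s)) (fun s => A' s (ψ' s)) (Set.uIoc 0 t) ∨ t < 0 := by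
    intro t ht
    rcases lt_or_ge t 0 with h | h
    · exact Or.inr h
    · left
      intro s hs
      rw [Set.uIoc_of_le h] at hs
      have : s ≤ T := hs.2.trans ht
      simp [hA', hψ', this]
  have e1 : ∀ t, 0 ≤ t → t ≤ T →
      Set.EqOn (fun s => A s (ψ s)) (fun s => A' s (ψ' s)) (Set.uIoc 0 t) := fun t h0 h =>
    (e1 t h).resolve_right (not_lt.mpr h0)
  have e2 : ∀ t, T ≤ t →
      Set.EqOn (fun s => X (exp ((s - T) • X) (ψ T))) (fun s => A' s (ψ' s)) (Set.uIoc T t) := by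
    intro t ht s hs
    rw [Set.uIoc_of_le ht] at hs
    have : ¬ s ≤ T := not_le.mpr hs.1
    simp [hA', hψ', this]
  have hcont : Continuous fun s : ℝ => X (exp ((s - T) • X) (ψ T)) := by
    refine X.continuous.comp (continuous_iff_continuousAt.mpr fun t => ?_)
    exact (hasDerivAt_exp_apply X (ψ T) T t).continuousAt
  have i1 : IntervalIntegrable (fun s => A' s (ψ' s)) volume 0 T := hint.congr (e1 T hT le_rfl)
  have i2 : ∀ t, T ≤ t → IntervalIntegrable (fun s => A' s (ψ' s)) volume T t := fun t ht =>
    (hcont.intervalIntegrable _ _).congr (e2 t ht)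
  have c1 : ∀ t, 0 ≤ t → t ≤ T → ∫ s in (0 : ℝ)..t, A' s (ψ' s) = ∫ s in (0 : ℝ)..t, A s (ψ s) :=
    fun t h0 h => intervalIntegral.integral_congr_ae
      (Eventually.of_forall fun s hs => (e1 t h0 h hs).symm)
  have c2 : ∀ t, T ≤ t → ∫ s in T..t, A' s (ψ' s) = exp ((t - T) • X) (ψ T) - ψ T := by
    intro t ht
    rw [intervalIntegral.integral_congr_ae
      (Eventually.of_forall fun s hs => (e2 t ht hs).symm)]
    rw [intervalIntegral.integral_eq_sub_of_hasDerivAt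
      (fun s _ => hasDerivAt_exp_apply X (ψ T) T s) (hcont.intervalIntegrable _ _)]
    simp
  refine ⟨i1.trans (i2 _ (by linarith)), fun t ht => ?_⟩
  have h0 : ψ' 0 = ψ 0 := by simp [hψ', hT]
  rcases le_or_gt t T with h | h
  · rw [h0, c1 t ht.1 h, ← hψ t ⟨ht.1, h⟩, hψ', if_pos h]
  · rw [h0, ← intervalIntegral.integral_add_adjacent_intervals i1 (i2 t h.le), c1 T hT le_rfl,
      c2 t h.le, ← add_assoc, ← hψ T ⟨hT, le_rfl⟩, hψ', if_neg (not_le.mpr h)]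
    abel

end
end SphereCtl

namespace SphereCtl
open NormedSpace Filter Topology MeasureTheory

section
variable {E : Type*} [NormedAddCommGroup E] [InnerProductSpace ℂ E] [FiniteDimensional ℂ E]

theorem exp_zero_smul_apply (X : E →L[ℂ] E) (x : E) : exp ((0 : ℝ) • X) x = x := by
  simp

theorem skew_of_selfAdjoint {Y : E →L[ℂ] E} (hY : star Y = Y) :
    star ((-Complex.I) • Y) = -((-Complex.I) • Y) := by
  rw [star_smul, hY]
  simp

end

section
variable {n m : ℕ}

/-- The operator `-i H(u)`. -/
noncomputable def Xop (Hmat : EuclideanSpace ℝ (Fin m) → Matrix (Fin n) (Fin n) ℂ)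
    (u : EuclideanSpace ℝ (Fin m)) : EuclideanSpace ℂ (Fin n) →L[ℂ] EuclideanSpace ℂ (Fin n) :=
  (-Complex.I) • Matrix.toEuclideanCLM (𝕜 := ℂ) (Hmat u)

theorem Xop_apply (Hmat : EuclideanSpace ℝ (Fin m) → Matrix (Fin n) (Fin n) ℂ)
    (u : EuclideanSpace ℝ (Fin m)) (x : EuclideanSpace ℂ (Fin n)) :
    Xop Hmat u x = (-Complex.I) • Matrix.toEuclideanLin (Hmat u) x := rfl

theorem Xop_skew {Hmat : EuclideanSpace ℝ (Fin m) → Matrix (Fin n) (Fin n) ℂ}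
    {u : EuclideanSpace ℝ (Fin m)} (h : (Hmat u).IsHermitian) :
    star (Xop Hmat u) = -Xop Hmat u := by
  have h1 : star (Hmat u) = Hmat u := h
  refine skew_of_selfAdjoint ?_
  rw [← map_star, h1]

theorem reach_sub_orb {U : Set (EuclideanSpace ℝ (Fin m))}
    {Hmat : EuclideanSpace ℝ (Fin m) → Matrix (Fin n) (Fin n) ℂ}
    (hherm : ∀ u ∈ U, (Hmat u).IsHermitian) (ψ0 : EuclideanSpace ℂ (Fin n)) :
    sphereReachable U Hmat ψ0 ⊆ orb (Xop Hmat '' U) ψ0 := by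
  rintro ψ1 ⟨T, hT, u, ψ, hu, ⟨_, hi, hψ⟩, rfl, rfl⟩
  refine traj_mem_orb ?_ hT (A := fun s => Xop Hmat (u s)) ?_ hi hψ
  · rintro _ ⟨v, hv, rfl⟩
    exact Xop_skew (hherm v hv)
  · intro t ht
    exact ⟨u t, hu.2.1 t ht, rfl⟩

theorem reach_step {U : Set (EuclideanSpace ℝ (Fin m))}
    {Hmat : EuclideanSpace ℝ (Fin m) → Matrix (Fin n) (Fin n) ℂ}
    (hherm : ∀ u ∈ U, (Hmat u).IsHermitian) {ψ0 ψ1 : EuclideanSpace ℂ (Fin n)}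
    (h1 : ψ1 ∈ sphereReachable U Hmat ψ0) {v : EuclideanSpace ℝ (Fin m)} (hv : v ∈ U)
    {τ : ℝ} (hτ : 0 ≤ τ) : exp (τ • Xop Hmat v) ψ1 ∈ sphereReachable U Hmat ψ0 := by
  obtain ⟨T, hT, u, ψ, ⟨hum, huU, C, hC⟩, ⟨hs, hi, hψ⟩, rfl, rfl⟩ := h1
  set u' : ℝ → EuclideanSpace ℝ (Fin m) := fun s => if s ≤ T then u s else v with hu'
  set ψ' : ℝ → EuclideanSpace ℂ (Fin n) :=
    fun s => if s ≤ T then ψ s else exp ((s - T) • Xop Hmat v) (ψ T) with hψ'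
  have happ := append_traj hT hτ (A := fun s => Xop Hmat (u s)) hi hψ (Xop Hmat v)
    (A' := fun s => Xop Hmat (u' s)) (ψ' := ψ')
    (fun s => by simp only [hu']; split_ifs <;> rfl) (fun s => rfl)
  refine ⟨T + τ, by linarith, u', ψ', ⟨?_, ?_, max C ‖v‖, ?_⟩, ⟨?_, happ.1, happ.2⟩, ?_, ?_⟩
  · have hpw : u' = Set.piecewise (Set.Iic T) u (fun _ => v) := by
      funext s
      simp [hu', Set.piecewise]
    rw [hpw]
    refine AEStronglyMeasurable.piecewise measurableSet_Iic ?_ aestronglyMeasurable_const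
    rw [Measure.restrict_restrict measurableSet_Iic]
    refine hum.mono_set ?_
    rintro s ⟨h1, h2⟩
    exact ⟨h2.1, h1⟩
  · intro t ht
    simp only [hu']
    split_ifs with h
    · exact huU t ⟨ht.1, h⟩
    · exact hv
  · intro t ht
    simp only [hu']
    split_ifs with h
    · exact (hC t ⟨ht.1, h⟩).trans (le_max_left _ _)
    · exact le_max_right _ _
  · intro t ht
    simp only [hψ']
    split_ifs with h
    · exact hs t ⟨ht.1, h⟩
    · rw [mem_sphere_zero_iff_norm]
      have := norm_unitary_apply (expU ((t - T) • Xop Hmat v) (skew_smul (Xop_skew (hherm v hv)) _)) (ψ T)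
      refine this.trans ?_
      simpa using hs T ⟨hT, le_rfl⟩
  · simp [hψ', hT]
  · simp only [hψ']
    split_ifs with h
    · have : τ = 0 := by linarith
      subst this
      rw [add_zero]
      exact (exp_zero_smul_apply (Xop Hmat v) (ψ T)).symm
    · rw [add_sub_cancel_left]

theorem reach_Am {U : Set (EuclideanSpace ℝ (Fin m))}
    {Hmat : EuclideanSpace ℝ (Fin m) → Matrix (Fin n) (Fin n) ℂ}
    (hherm : ∀ u ∈ U, (Hmat u).IsHermitian) (hU : U.Nonempty) {ψ0 : EuclideanSpace ℂ (Fin n)}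
    (hψ0 : ψ0 ∈ Metric.sphere (0 : EuclideanSpace ℂ (Fin n)) 1)
    {a : unitary (EuclideanSpace ℂ (Fin n) →L[ℂ] EuclideanSpace ℂ (Fin n))}
    (ha : a ∈ Am (Xop Hmat '' U)) :
    (a : EuclideanSpace ℂ (Fin n) →L[ℂ] EuclideanSpace ℂ (Fin n)) ψ0 ∈ sphereReachable U Hmat ψ0 := by
  refine Submonoid.closure_induction_left
    (motive := fun (a : unitary (EuclideanSpace ℂ (Fin n) →L[ℂ] EuclideanSpace ℂ (Fin n))) _ =>
      (a : EuclideanSpace ℂ (Fin n) →L[ℂ] EuclideanSpace ℂ (Fin n)) ψ0 ∈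
      sphereReachable U Hmat ψ0) ?_ ?_ ha
  · obtain ⟨v, hv⟩ := hU
    refine ⟨0, le_rfl, fun _ => v, fun _ => ψ0,
      ⟨aestronglyMeasurable_const, fun _ _ => hv, ‖v‖, fun _ _ => le_rfl⟩,
      ⟨fun _ _ => hψ0, by simp, ?_⟩, rfl, by simp⟩
    intro t ht
    have : t = 0 := le_antisymm ht.2 ht.1
    simp [this]
  · rintro x ⟨_, ⟨v, hv, rfl⟩, t, ht, hx⟩ y _ hy
    rw [Submonoid.coe_mul, mul_apply_eq_comp, hx]
    exact reach_step hherm hy hv ht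

end
end SphereCtl

/-- Theorem 4.1 of the paper. For a quantum control system
`i·ψ̇ = H(u)·ψ` on the unit sphere of `ℂ^n` (with `u ↦ H(u)` a smooth family of
Hermitian matrices), approximate controllability is equivalent to exact
controllability. -/
theorem approx_iff_exact_controllability_sphere {n m : ℕ} (hn : 2 ≤ n)
    (U : Set (EuclideanSpace ℝ (Fin m)))
    (Hmat : EuclideanSpace ℝ (Fin m) → Matrix (Fin n) (Fin n) ℂ)
    (hherm : ∀ u ∈ U, (Hmat u).IsHermitian)
    (hsmooth : ContDiffOn ℝ (⊤ : ℕ∞) Hmat U) :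
    (∀ ψ0 ∈ Metric.sphere (0 : EuclideanSpace ℂ (Fin n)) 1,
      Metric.sphere (0 : EuclideanSpace ℂ (Fin n)) 1 ⊆ closure (sphereReachable U Hmat ψ0)) ↔
    (∀ ψ0 ∈ Metric.sphere (0 : EuclideanSpace ℂ (Fin n)) 1,
      sphereReachable U Hmat ψ0 = Metric.sphere (0 : EuclideanSpace ℂ (Fin n)) 1) := by
  have hnt : Nontrivial (EuclideanSpace ℂ (Fin n)) := by
    have : Nonempty (Fin n) := ⟨⟨0, by omega⟩⟩
    infer_instance
  constructor
  · intro h ψ0 hψ0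
    have h𝒳 : ∀ X ∈ SphereCtl.Xop Hmat '' U, star X = -X := by
      rintro _ ⟨v, hv, rfl⟩
      exact SphereCtl.Xop_skew (hherm v hv)
    have ht : SphereCtl.Trans (SphereCtl.Xop Hmat '' U) := by
      intro ψ φ hψ hφ
      have h1 := h ψ (by simpa using hψ) (show φ ∈ _ by simpa using hφ)
      have h2 := closure_minimal (SphereCtl.reach_sub_orb hherm ψ)
        (SphereCtl.isClosed_orb (SphereCtl.Xop Hmat '' U) ψ) h1
      obtain ⟨g, hg, hgφ⟩ := h2
      exact ⟨g, hg, hgφ⟩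
    have hU : U.Nonempty := by
      have h1 : (sphereReachable U Hmat ψ0).Nonempty :=
        closure_nonempty_iff.mp ⟨ψ0, h ψ0 hψ0 hψ0⟩
      obtain ⟨_, T, hT, u, ψ, hu, -⟩ := h1
      exact ⟨u 0, hu.2.1 0 ⟨le_rfl, hT⟩⟩
    refine Set.Subset.antisymm ?_ ?_
    · rintro _ ⟨T, hT, u, ψ, -, hψ, -, rfl⟩
      exact hψ.1 T ⟨hT, le_rfl⟩
    · intro φ hφ
      obtain ⟨a, ha, rfl⟩ := SphereCtl.exact_reach h𝒳 ht (ψ := ψ0) (φ := φ)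
        (by simpa using hψ0) (by simpa using hφ)
      exact SphereCtl.reach_Am hherm hU hψ0 ha
  · intro h ψ0 hψ0
    rw [h ψ0 hψ0]
    exact subset_closure
end

section
/- Let n ≥ 2, U ⊆ ℝ^m, and let u ↦ H(u) assign to each u ∈ U an n×n complex Hermitian matrix with zero trace, depending smoothly on u. Then every admissible trajectory of the lifted control system i·ġ(t) = H(u(t))·g(t) starting in the special unitary group SU(n) remains in SU(n), and the lifted system is approximately controllable in SU(n) (every reachable set is dense in SU(n)) if and only if it is exactly controllable in SU(n) (every reachable set equals SU(n)). -/
attribute [local instance] Matrix.normedAddCommGroup Matrix.normedSpace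

open MeasureTheory in
theorem pi_intervalIntegrable {n : ℕ} (f : ℝ → Fin n → Fin n → ℂ) (a b : ℝ) :
    IntervalIntegrable f volume a b ↔ ∀ i j, IntervalIntegrable (fun s => f s i j) volume a b := by
  constructor
  · intro h i j
    exact ⟨(h.1.eval i).eval j, (h.2.eval i).eval j⟩
  · intro h
    exact ⟨Integrable.of_eval fun i => Integrable.of_eval fun j => (h i j).1,
      Integrable.of_eval fun i => Integrable.of_eval fun j => (h i j).2⟩

open MeasureTheory in
theorem pi_intervalIntegral {n : ℕ} (f : ℝ → Fin n → Fin n → ℂ) (a b : ℝ)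
    (h : IntervalIntegrable f volume a b) (i j : Fin n) :
    (∫ s in a..b, f s) i j = ∫ s in a..b, f s i j := by
  have hc : ∀ c d, IntegrableOn f (Set.Ioc c d) → 
     (∫ s in Set.Ioc c d, f s) i j = ∫ s in Set.Ioc c d, f s i j := by
    intro c d h
    rw [eval_integral (fun i => h.eval i), eval_integral (fun j => (h.eval i).eval j)]
  simp only [intervalIntegral, Pi.sub_apply, hc _ _ h.1, hc _ _ h.2]

/-- Entrywise form of the trajectory condition. -/
theorem traj_iff {n m : ℕ} {Hmat : EuclideanSpace ℝ (Fin m) → Matrix (Fin n) (Fin n) ℂ}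
    {T : ℝ} {u : ℝ → EuclideanSpace ℝ (Fin m)} {g : ℝ → Matrix (Fin n) (Fin n) ℂ} :
    IsLiftedTrajectory Hmat T u g ↔
    (∀ t ∈ Set.Icc 0 T, g t ∈ Matrix.unitaryGroup (Fin n) ℂ) ∧
    (∀ i j, IntervalIntegrable (fun s => (-Complex.I) * (Hmat (u s) * g s) i j)
      MeasureTheory.volume 0 T) ∧
    ∀ t ∈ Set.Icc 0 T, ∀ i j,
      g t i j = g 0 i j + ∫ s in (0:ℝ)..t, (-Complex.I) * (Hmat (u s) * g s) i j := by
  let F : ℝ → Fin n → Fin n → ℂ := fun s =>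
    ((-Complex.I) • (Hmat (u s) * g s) : Matrix (Fin n) (Fin n) ℂ)
  have h2 := pi_intervalIntegrable F 0 T
  constructor
  · rintro ⟨a, b, c⟩
    refine ⟨a, h2.1 b, fun t ht i j => ?_⟩
    have hb : IntervalIntegrable F MeasureTheory.volume 0 t :=
      IntervalIntegrable.mono_set (b := T) b (by
        rw [Set.uIcc_of_le (ht.1.trans ht.2), Set.uIcc_of_le ht.1]
        exact Set.Icc_subset_Icc_right ht.2)
    have := pi_intervalIntegral _ 0 t hb i j
    refine (congrFun (congrFun (c t ht) i) j).trans ?_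
    refine congrArg (fun z => g 0 i j + z) ?_
    exact this
  · rintro ⟨a, b, c⟩
    have b' := h2.2 b
    refine ⟨a, b', fun t ht => ?_⟩
    have hb : IntervalIntegrable F MeasureTheory.volume 0 t :=
      IntervalIntegrable.mono_set (b := T) b' (by
        rw [Set.uIcc_of_le (ht.1.trans ht.2), Set.uIcc_of_le ht.1]
        exact Set.Icc_subset_Icc_right ht.2)
    ext i j
    have := pi_intervalIntegral _ 0 t hb i j
    refine (c t ht i j).trans ?_
    refine congrArg (fun z => g 0 i j + z) ?_
    exact this.symm

open MeasureTheory in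
theorem traj_mul_right {n m : ℕ} {Hmat : EuclideanSpace ℝ (Fin m) → Matrix (Fin n) (Fin n) ℂ}
    {T : ℝ} {u : ℝ → EuclideanSpace ℝ (Fin m)} {g : ℝ → Matrix (Fin n) (Fin n) ℂ}
    (hg : IsLiftedTrajectory Hmat T u g) {h : Matrix (Fin n) (Fin n) ℂ}
    (hh : h ∈ Matrix.unitaryGroup (Fin n) ℂ) :
    IsLiftedTrajectory Hmat T u (fun t => g t * h) := by
  obtain ⟨h1, h2, h3⟩ := traj_iff.1 hg
  have e : ∀ i j, (fun s => (-Complex.I) * (Hmat (u s) * (g s * h)) i j) =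
      fun s => ∑ k, ((-Complex.I) * (Hmat (u s) * g s) i k) * h k j := by
    intro i j
    ext1 s
    rw [← mul_assoc, Matrix.mul_apply, Finset.mul_sum]
    simp only [mul_assoc]
  have h2' : ∀ i j k, IntervalIntegrable
      (fun s => ((-Complex.I) * (Hmat (u s) * g s) i k) * h k j) volume 0 T :=
    fun i j k => (h2 i k).mul_const _
  refine traj_iff.2 ⟨fun t ht => mul_mem (h1 t ht) hh, ?_, ?_⟩
  · intro i j
    rw [e]
    have := IntervalIntegrable.sum Finset.univ (fun k _ => h2' i j k)
    simpa only [Finset.sum_fn] using this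
  · intro t ht i j
    have hsub : Set.uIcc 0 t ⊆ Set.uIcc 0 T := by
      rw [Set.uIcc_of_le (ht.1.trans ht.2), Set.uIcc_of_le ht.1]
      exact Set.Icc_subset_Icc_right ht.2
    rw [e, intervalIntegral.integral_finsetSum (fun k _ => (h2' i j k).mono_set hsub)]
    simp only [intervalIntegral.integral_mul_const, Matrix.mul_apply (M := g _) (N := h)]
    rw [← Finset.sum_add_distrib]
    refine Finset.sum_congr rfl fun k _ => ?_
    rw [← add_mul, ← h3 t ht]

theorem hasDerivAt_mexp_entry {n : ℕ} (A : Matrix (Fin n) (Fin n) ℂ) (t : ℝ) (i j : Fin n) :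
    HasDerivAt (fun s : ℝ => NormedSpace.exp (s • A) i j)
      ((A * NormedSpace.exp (t • A)) i j) t := by
  let e : ℝ → Fin n → Fin n → ℂ := fun s =>
    (NormedSpace.exp (s • A) : Matrix (Fin n) (Fin n) ℂ)
  let e' : Fin n → Fin n → ℂ := (A * NormedSpace.exp (t • A) : Matrix (Fin n) (Fin n) ℂ)
  have h : HasDerivAt e e' t :=
    letI : NormedRing (Matrix (Fin n) (Fin n) ℂ) := Matrix.linftyOpNormedRing
    letI : NormedAlgebra ℝ (Matrix (Fin n) (Fin n) ℂ) := Matrix.linftyOpNormedAlgebra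
    haveI : @CompleteSpace (Matrix (Fin n) (Fin n) ℂ)
      (Matrix.linftyOpNormedRing.toUniformSpace) := FiniteDimensional.complete ℝ _
    hasDerivAt_exp_smul_const' (𝕂 := ℝ) A t
  exact hasDerivAt_pi.1 (hasDerivAt_pi.1 h i) j

open MeasureTheory in
theorem reach_concat {n m : ℕ} {U : Set (EuclideanSpace ℝ (Fin m))}
    {Hmat : EuclideanSpace ℝ (Fin m) → Matrix (Fin n) (Fin n) ℂ}
    {g0 g1 g2 : Matrix (Fin n) (Fin n) ℂ} (h1 : g1 ∈ liftedReachable U Hmat g0)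
    (h2 : g2 ∈ liftedReachable U Hmat g1) : g2 ∈ liftedReachable U Hmat g0 := by
  obtain ⟨T₁, hT₁, u₁, p₁, ⟨um₁, uU₁, C₁, hC₁⟩, hp₁, rfl, rfl⟩ := h1
  obtain ⟨T₂, hT₂, u₂, p₂, ⟨um₂, uU₂, C₂, hC₂⟩, hp₂, h0, rfl⟩ := h2
  obtain ⟨a1, a2, a3⟩ := traj_iff.1 hp₁
  obtain ⟨b1, b2, b3⟩ := traj_iff.1 hp₂
  have hT : 0 ≤ T₁ + T₂ := add_nonneg hT₁ hT₂
  set u : ℝ → EuclideanSpace ℝ (Fin m) := fun s => if s ≤ T₁ then u₁ s else u₂ (s - T₁) with hu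
  set p : ℝ → Matrix (Fin n) (Fin n) ℂ := fun s => if s ≤ T₁ then p₁ s else p₂ (s - T₁) with hp
  have eu1 : ∀ s, s ≤ T₁ → u s = u₁ s := fun s hs => if_pos hs
  have eu2 : ∀ s, T₁ < s → u s = u₂ (s - T₁) := fun s hs => if_neg (not_le.2 hs)
  have ep1 : ∀ s, s ≤ T₁ → p s = p₁ s := fun s hs => if_pos hs
  have ep2 : ∀ s, T₁ < s → p s = p₂ (s - T₁) := fun s hs => if_neg (not_le.2 hs)
  have ep2' : ∀ s, T₁ ≤ s → p s = p₂ (s - T₁) := by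
    intro s hs
    rcases hs.eq_or_lt with rfl | h
    · rw [ep1 _ le_rfl, sub_self, h0]
    · exact ep2 s h
  have f1 : ∀ i j, ∀ b, b ≤ T₁ → Set.EqOn (fun s => (-Complex.I) * (Hmat (u₁ s) * p₁ s) i j)
      (fun s => (-Complex.I) * (Hmat (u s) * p s) i j) (Set.Ioc 0 b) := by
    intro i j b hb s hs
    simp only [eu1 s (hs.2.trans hb), ep1 s (hs.2.trans hb)]
  have f2 : ∀ i j, ∀ b, Set.EqOn
      (fun s => (-Complex.I) * (Hmat (u₂ (s - T₁)) * p₂ (s - T₁)) i j)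
      (fun s => (-Complex.I) * (Hmat (u s) * p s) i j) (Set.Ioc T₁ b) := by
    intro i j b s hs
    simp only [eu2 s hs.1, ep2 s hs.1]
  have i1 : ∀ i j, IntervalIntegrable (fun s => (-Complex.I) * (Hmat (u s) * p s) i j)
      volume 0 T₁ := by
    intro i j
    refine (a2 i j).congr ?_
    rw [Set.uIoc_of_le hT₁]
    exact f1 i j _ le_rfl
  have i2' : ∀ i j, IntervalIntegrable
      (fun s => (-Complex.I) * (Hmat (u₂ (s - T₁)) * p₂ (s - T₁)) i j)
      volume T₁ (T₁ + T₂) := by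
    intro i j
    have := (b2 i j).comp_sub_right T₁
    rwa [zero_add, add_comm] at this
  have i2 : ∀ i j, IntervalIntegrable (fun s => (-Complex.I) * (Hmat (u s) * p s) i j)
      volume T₁ (T₁ + T₂) := by
    intro i j
    refine (i2' i j).congr ?_
    rw [Set.uIoc_of_le (by linarith)]
    exact f2 i j _
  have int1 : ∀ i j, ∀ t, 0 ≤ t → t ≤ T₁ →
      p₁ t i j = p₁ 0 i j + ∫ s in (0:ℝ)..t, (-Complex.I) * (Hmat (u s) * p s) i j := by
    intro i j t h0t ht
    rw [a3 t ⟨h0t, ht⟩ i j]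
    congr 1
    rw [intervalIntegral.integral_of_le h0t, intervalIntegral.integral_of_le h0t]
    exact setIntegral_congr_fun measurableSet_Ioc (f1 i j t ht)
  refine ⟨T₁ + T₂, hT, u, p, ⟨?_, ?_, max C₁ C₂, ?_⟩, traj_iff.2 ⟨?_, ?_, ?_⟩, ?_, ?_⟩
  · have hs : Set.Icc 0 (T₁ + T₂) = Set.Icc 0 T₁ ∪ Set.Ioc T₁ (T₁ + T₂) := by
      rw [Set.Icc_union_Ioc_eq_Icc hT₁ (by linarith)]
    rw [hs, aestronglyMeasurable_union_iff]
    constructor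
    · refine um₁.congr ?_
      filter_upwards [ae_restrict_mem measurableSet_Icc] with s hs
      exact (eu1 s hs.2).symm
    · have mp : MeasurePreserving (fun s : ℝ => s - T₁) volume volume :=
        measurePreserving_sub_right volume T₁
      have mp' := mp.restrict_preimage (s := Set.Icc 0 T₂) measurableSet_Icc
      have h3 := um₂.comp_measurePreserving mp'
      have h4 : AEStronglyMeasurable (u₂ ∘ fun s : ℝ => s - T₁)
          (volume.restrict (Set.Ioc T₁ (T₁ + T₂))) := by
        refine h3.mono_measure (Measure.restrict_mono ?_ le_rfl)
        intro s hs
        simp only [Set.mem_preimage, Set.mem_Icc]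
        constructor <;> linarith [hs.1, hs.2]
      refine h4.congr ?_
      filter_upwards [ae_restrict_mem measurableSet_Ioc] with s hs
      exact (eu2 s hs.1).symm
  · intro t ht
    rcases le_or_gt t T₁ with h | h
    · rw [eu1 t h]; exact uU₁ t ⟨ht.1, h⟩
    · rw [eu2 t h]; exact uU₂ _ ⟨by linarith, by linarith [ht.2]⟩
  · intro t ht
    rcases le_or_gt t T₁ with h | h
    · rw [eu1 t h]; exact (hC₁ t ⟨ht.1, h⟩).trans (le_max_left _ _)
    · rw [eu2 t h]; exact (hC₂ _ ⟨by linarith, by linarith [ht.2]⟩).trans (le_max_right _ _)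
  · intro t ht
    rcases le_or_gt t T₁ with h | h
    · rw [ep1 t h]; exact a1 t ⟨ht.1, h⟩
    · rw [ep2 t h]; exact b1 _ ⟨by linarith, by linarith [ht.2]⟩
  · intro i j
    exact (i1 i j).trans (i2 i j)
  · intro t ht i j
    rcases le_or_gt t T₁ with h | h
    · rw [ep1 t h, ep1 0 hT₁, int1 i j t ht.1 h]
    · have hsub : IntervalIntegrable (fun s => (-Complex.I) * (Hmat (u s) * p s) i j)
          volume T₁ t := by
        refine (i2 i j).mono_set ?_
        rw [Set.uIcc_of_le h.le, Set.uIcc_of_le (by linarith)]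
        exact Set.Icc_subset_Icc_right ht.2
      rw [← intervalIntegral.integral_add_adjacent_intervals (i1 i j) hsub, ← add_assoc,
        ep1 0 hT₁, ← int1 i j T₁ hT₁ le_rfl, ep2 t h, ← h0,
        b3 (t - T₁) ⟨by linarith, by linarith [ht.2]⟩ i j]
      congr 1
      have := intervalIntegral.integral_comp_sub_right (a := T₁) (b := t)
        (fun s => (-Complex.I) * (Hmat (u₂ s) * p₂ s) i j) T₁
      rw [sub_self] at this
      rw [← this, intervalIntegral.integral_of_le h.le, intervalIntegral.integral_of_le h.le]
      exact setIntegral_congr_fun measurableSet_Ioc (f2 i j t)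
  · exact ep1 0 hT₁
  · rw [ep2' _ (by linarith), add_sub_cancel_left]

theorem reach_mul_right {n m : ℕ} {U : Set (EuclideanSpace ℝ (Fin m))}
    {Hmat : EuclideanSpace ℝ (Fin m) → Matrix (Fin n) (Fin n) ℂ}
    {g h : Matrix (Fin n) (Fin n) ℂ} (hg : g ∈ liftedReachable U Hmat 1)
    (hh : h ∈ Matrix.unitaryGroup (Fin n) ℂ) : g * h ∈ liftedReachable U Hmat h := by
  obtain ⟨T, hT, u, p, hu, hp, h0, rfl⟩ := hg
  exact ⟨T, hT, u, _, hu, traj_mul_right hp hh, by simp [h0], rfl⟩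

theorem reach_unitary {n m : ℕ} {U : Set (EuclideanSpace ℝ (Fin m))}
    {Hmat : EuclideanSpace ℝ (Fin m) → Matrix (Fin n) (Fin n) ℂ}
    {g h : Matrix (Fin n) (Fin n) ℂ} (hg : g ∈ liftedReachable U Hmat h) :
    g ∈ Matrix.unitaryGroup (Fin n) ℂ := by
  obtain ⟨T, hT, u, p, hu, hp, h0, rfl⟩ := hg
  exact hp.1 T ⟨hT, le_rfl⟩

theorem reach_mul {n m : ℕ} {U : Set (EuclideanSpace ℝ (Fin m))}
    {Hmat : EuclideanSpace ℝ (Fin m) → Matrix (Fin n) (Fin n) ℂ}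
    {g h : Matrix (Fin n) (Fin n) ℂ} (hg : g ∈ liftedReachable U Hmat 1)
    (hh : h ∈ liftedReachable U Hmat 1) : g * h ∈ liftedReachable U Hmat 1 :=
  reach_concat hh (reach_mul_right hg (reach_unitary hh))

theorem mexp_unitary {n : ℕ} {H : Matrix (Fin n) (Fin n) ℂ} (hH : H.IsHermitian) (t : ℝ) :
    NormedSpace.exp (t • ((-Complex.I) • H)) ∈ Matrix.unitaryGroup (Fin n) ℂ := by
  have e : (t • ((-Complex.I) • H)).conjTranspose = -(t • ((-Complex.I) • H)) := by
    rw [Matrix.conjTranspose_smul, Matrix.conjTranspose_smul, hH.eq]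
    simp
  rw [Matrix.mem_unitaryGroup_iff, Matrix.star_eq_conjTranspose, ← Matrix.exp_conjTranspose, e,
    ← Matrix.exp_add_of_commute _ _ (Commute.neg_right (Commute.refl (t • ((-Complex.I) • H)))), add_neg_cancel,
    NormedSpace.exp_zero]

theorem reach_exp {n m : ℕ} {U : Set (EuclideanSpace ℝ (Fin m))}
    {Hmat : EuclideanSpace ℝ (Fin m) → Matrix (Fin n) (Fin n) ℂ}
    {v : EuclideanSpace ℝ (Fin m)} (hv : v ∈ U) (hH : (Hmat v).IsHermitian) {t : ℝ} (ht : 0 ≤ t) :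
    NormedSpace.exp (t • ((-Complex.I) • Hmat v)) ∈ liftedReachable U Hmat 1 := by
  set A := (-Complex.I) • Hmat v with hA
  have hd := fun i j s => hasDerivAt_mexp_entry A s i j
  have hcont : ∀ i j, Continuous fun s : ℝ => (NormedSpace.exp (s • A)) i j := fun i j =>
    continuous_iff_continuousAt.2 fun s => (hd i j s).continuousAt
  have hcont' : ∀ i j, Continuous fun s : ℝ => (A * NormedSpace.exp (s • A)) i j := by
    intro i j
    simp only [Matrix.mul_apply]
    exact continuous_finsetSum _ fun k _ => continuous_const.mul (hcont k j)
  have e : ∀ i j, (fun s : ℝ => (-Complex.I) * (Hmat v * NormedSpace.exp (s • A)) i j) =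
      fun s => (A * NormedSpace.exp (s • A)) i j := by
    intro i j; ext1 s; rw [hA, smul_mul_assoc]; rfl
  refine ⟨t, ht, fun _ => v, fun s => NormedSpace.exp (s • A),
    ⟨MeasureTheory.aestronglyMeasurable_const, fun _ _ => hv, ‖v‖, fun _ _ => le_rfl⟩,
    traj_iff.2 ⟨fun s _ => mexp_unitary hH s, ?_, ?_⟩, ?_, rfl⟩
  · intro i j
    rw [e]
    exact (hcont' i j).intervalIntegrable _ _
  · intro s hs i j
    rw [e, intervalIntegral.integral_eq_sub_of_hasDerivAt (fun x _ => hd i j x)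
      ((hcont' i j).intervalIntegrable _ _)]
    ring
  · simp only [zero_smul, NormedSpace.exp_zero]

open MeasureTheory in
theorem ac_const {E : Type*} [NormedAddCommGroup E] (c : E) (a b : ℝ) :
    AbsolutelyContinuousOnInterval (fun _ : ℝ => c) a b :=
  (LipschitzWith.const c).lipschitzOnWith.absolutelyContinuousOnInterval

theorem ac_congr {E : Type*} [NormedAddCommGroup E] {f g : ℝ → E} {a b : ℝ}
    (hf : AbsolutelyContinuousOnInterval f a b) (h : ∀ x ∈ Set.uIcc a b, f x = g x) :
    AbsolutelyContinuousOnInterval g a b := by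
  rw [absolutelyContinuousOnInterval_iff] at hf ⊢
  intro ε hε
  obtain ⟨δ, hδ, H⟩ := hf ε hε
  refine ⟨δ, hδ, fun E hE hd => ?_⟩
  have := H E hE hd
  rwa [Finset.sum_congr rfl fun i hi => by
    rw [h _ (hE.1 i hi).1, h _ (hE.1 i hi).2]] at this

open MeasureTheory in
theorem ac_integral {f : ℝ → ℂ} {a b : ℝ} (h : IntervalIntegrable f volume a b) :
    AbsolutelyContinuousOnInterval (fun x => ∫ s in a..x, f s) a b := by
  have hre : IntervalIntegrable (fun s => (f s).re) volume a b := ⟨h.1.re, h.2.re⟩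
  have him : IntervalIntegrable (fun s => (f s).im) volume a b := ⟨h.1.im, h.2.im⟩
  have A := (hre.absolutelyContinuousOnInterval_intervalIntegral Set.left_mem_uIcc).smul
    (ac_const (1 : ℂ) a b)
  have B := (him.absolutelyContinuousOnInterval_intervalIntegral Set.left_mem_uIcc).smul
    (ac_const (Complex.I : ℂ) a b)
  refine ac_congr (A.add B) ?_
  intro x hx
  have hx' : IntervalIntegrable f volume a x :=
    h.mono_set (Set.uIcc_subset_uIcc_left hx)
  have e1 := Complex.reCLM.intervalIntegral_comp_comm hx'
  have e2 := Complex.imCLM.intervalIntegral_comp_comm hx'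
  simp only [Complex.reCLM_apply, Complex.imCLM_apply] at e1 e2
  apply Complex.ext <;> simp [e1, e2]

theorem ac_sum {ι : Type*} (s : Finset ι) {f : ι → ℝ → ℂ} {a b : ℝ}
    (h : ∀ i ∈ s, AbsolutelyContinuousOnInterval (f i) a b) :
    AbsolutelyContinuousOnInterval (fun x => ∑ i ∈ s, f i x) a b := by
  classical
  induction s using Finset.induction_on with
  | empty => simpa using ac_const (0 : ℂ) a b
  | insert i s hi ih =>
    simp only [Finset.sum_insert hi]
    exact (h i (by simp)).add (ih fun j hj => h j (by simp [hj]))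

theorem ac_prod {ι : Type*} (s : Finset ι) {f : ι → ℝ → ℂ} {a b : ℝ}
    (h : ∀ i ∈ s, AbsolutelyContinuousOnInterval (f i) a b) :
    AbsolutelyContinuousOnInterval (fun x => ∏ i ∈ s, f i x) a b := by
  classical
  induction s using Finset.induction_on with
  | empty => simpa using ac_const (1 : ℂ) a b
  | insert i s hi ih =>
    simp only [Finset.prod_insert hi]
    exact (h i (by simp)).smul (ih fun j hj => h j (by simp [hj]))

theorem ac_det {n : ℕ} {g : ℝ → Matrix (Fin n) (Fin n) ℂ} {a b : ℝ}
    (h : ∀ i j, AbsolutelyContinuousOnInterval (fun t => g t i j) a b) :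
    AbsolutelyContinuousOnInterval (fun t => (g t).det) a b := by
  simp only [Matrix.det_apply']
  refine ac_sum _ fun σ _ => ?_
  have hp := ac_prod Finset.univ (f := fun i t => g t (σ i) i) (a := a) (b := b)
    (fun i _ => h (σ i) i)
  exact (ac_const ((Equiv.Perm.sign σ : ℤ) : ℂ) a b).smul hp

/-- Jacobi's formula for a curve with `g' = A g` at a point. -/
theorem hasDerivAt_det_of {n : ℕ} {g : ℝ → Matrix (Fin n) (Fin n) ℂ}
    {A : Matrix (Fin n) (Fin n) ℂ} {t : ℝ}
    (h : ∀ i j, HasDerivAt (fun t => g t i j) ((A * g t) i j) t) (hA : A.trace = 0) :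
    HasDerivAt (fun t => (g t).det) 0 t := by
  -- the derivative of `det` only depends on the value and derivative of the curve
  have key : ∀ p : ℝ → Matrix (Fin n) (Fin n) ℂ, p t = g t →
      (∀ i j, HasDerivAt (fun t => p t i j) ((A * g t) i j) t) →
      HasDerivAt (fun t => (p t).det) (∑ σ : Equiv.Perm (Fin n), ((Equiv.Perm.sign σ : ℤ) : ℂ) *
        ∑ i, (∏ j ∈ Finset.univ.erase i, g t (σ j) j) • (A * g t) (σ i) i) t := by
    intro p hp hd
    simp only [Matrix.det_apply']
    refine HasDerivAt.fun_sum fun σ _ => HasDerivAt.const_mul _ ?_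
    have := HasDerivAt.fun_finsetProd (u := Finset.univ) (f := fun i s => p s (σ i) i)
      (f' := fun i => (A * g t) (σ i) i) (x := t) (fun i _ => hd (σ i) i)
    simpa only [hp] using this
  have k1 := key g rfl h
  have k2 := key (fun s => (1 + ((s - t : ℝ) : ℂ) • A) * g t) (by simp) (by
    intro i j
    have : (fun s : ℝ => ((1 + ((s - t : ℝ) : ℂ) • A) * g t) i j) =
        fun s => g t i j + ((s - t : ℝ) : ℂ) * (A * g t) i j := by
      ext1 s; rw [add_mul, one_mul, smul_mul_assoc]; rfl
    rw [this]
    have h1 : HasDerivAt (fun s : ℝ => ((s - t : ℝ) : ℂ)) ((1 : ℝ) : ℂ) t :=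
      ((hasDerivAt_id t).sub_const t).ofReal_comp
    simpa using (h1.mul_const ((A * g t) i j)).const_add (g t i j))
  have k3 : HasDerivAt (fun s : ℝ => ((1 + ((s - t : ℝ) : ℂ) • A) * g t).det) 0 t := by
    have e : (fun s : ℝ => ((1 + ((s - t : ℝ) : ℂ) • A) * g t).det) = fun s : ℝ => 
       ((Matrix.det (1 + (Polynomial.X : Polynomial ℂ) • A.map Polynomial.C)).eval ((s - t : ℝ) : ℂ)) * (g t).det := by
      ext1 s
      rw [Matrix.det_mul, ← Polynomial.coe_evalRingHom, RingHom.map_det]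
      congr 2
      ext i j
      simp [Matrix.one_apply, apply_ite]
      ring
    rw [e]
    have h1 : HasDerivAt (fun s : ℝ => ((s - t : ℝ) : ℂ)) ((1 : ℝ) : ℂ) t :=
      ((hasDerivAt_id t).sub_const t).ofReal_comp
    have h2 := (Polynomial.hasDerivAt (Matrix.det (1 + (Polynomial.X : Polynomial ℂ) • A.map Polynomial.C)) ((t - t : ℝ) : ℂ))
    have h3 := (HasDerivAt.comp t h2 h1).mul_const (g t).det
    have := Matrix.derivative_det_one_add_X_smul A
    rw [sub_self, Complex.ofReal_zero, this, hA, zero_mul, zero_mul] at h3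
    exact h3
  rw [k2.unique k3] at k1
  exact k1

open MeasureTheory in
theorem traj_det {n m : ℕ} {U : Set (EuclideanSpace ℝ (Fin m))}
    {Hmat : EuclideanSpace ℝ (Fin m) → Matrix (Fin n) (Fin n) ℂ}
    (htrace : ∀ u ∈ U, (Hmat u).trace = 0)
    {T : ℝ} {u : ℝ → EuclideanSpace ℝ (Fin m)} {g : ℝ → Matrix (Fin n) (Fin n) ℂ} (hT : 0 ≤ T)
    (hu : IsAdmissibleControl U T u)
    (hg : IsLiftedTrajectory Hmat T u g) (t : ℝ) (ht : t ∈ Set.Icc 0 T) :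
    (g t).det = (g 0).det := by
  obtain ⟨h1, h2, h3⟩ := traj_iff.1 hg
  set p : ℝ → Matrix (Fin n) (Fin n) ℂ := fun t => Matrix.of fun i j =>
    g 0 i j + ∫ s in (0:ℝ)..t, (-Complex.I) * (Hmat (u s) * g s) i j with hp
  have hpe : ∀ t i j, p t i j =
    g 0 i j + ∫ s in (0:ℝ)..t, (-Complex.I) * (Hmat (u s) * g s) i j := fun _ _ _ => rfl
  have hpg : ∀ t ∈ Set.Icc 0 T, p t = g t := by
    intro t ht
    ext i j
    rw [h3 t ht i j, hpe]
  have hac : AbsolutelyContinuousOnInterval (fun t => (p t).det) 0 T :=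
    ac_det fun i j => (ac_const (g 0 i j) 0 T).add (ac_integral (h2 i j))
  have hd : ∀ᵐ x, x ∈ Set.uIcc 0 T → HasDerivAt (fun t => (p t).det) 0 x := by
    have : ∀ i j, ∀ᵐ x, x ∈ Set.uIcc 0 T → HasDerivAt
        (fun x => ∫ s in (0:ℝ)..x, (-Complex.I) * (Hmat (u s) * g s) i j)
        ((-Complex.I) * (Hmat (u x) * g x) i j) x := by
      intro i j
      filter_upwards [(h2 i j).ae_hasDerivAt_integral] with x hx hxT
      exact hx hxT 0 Set.left_mem_uIcc
    have := ae_all_iff.2 fun i => ae_all_iff.2 fun j => this i j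
    filter_upwards [this] with x hx hxT
    have hxT' := hxT
    rw [Set.uIcc_of_le hT] at hxT'
    refine hasDerivAt_det_of (A := (-Complex.I) • Hmat (u x)) ?_ ?_
    · intro i j
      have := (hx i j hxT).const_add (g 0 i j)
      rw [hpg x hxT', smul_mul_assoc]
      exact this
    · rw [Matrix.trace_smul, htrace _ (hu.2.1 x hxT'), smul_zero]
  obtain ⟨C, hC⟩ := hac.const_of_ae_hasDerivAt_zero hd
  rw [Set.uIcc_of_le hT] at hC
  have e1 := hC t ht
  have e2 := hC 0 ⟨le_rfl, hT⟩
  rw [hpg t ht] at e1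
  rw [hpg 0 ⟨le_rfl, hT⟩] at e2
  rw [e1, e2]

/-- Rank-maximal families of products of exponentials. -/
def KrenerRank {𝔸 : Type} [NormedRing 𝔸] [NormedAlgebra ℝ 𝔸] (S : Submonoid 𝔸) (d : ℕ) : Prop :=
  ∃ (E : Type) (_ : NormedAddCommGroup E) (_ : NormedSpace ℝ E) (_ : CompleteSpace E)
    (Φ : E → 𝔸) (τ : E) (Φ' : E →L[ℝ] 𝔸), HasStrictFDerivAt Φ Φ' τ ∧
    (∀ᶠ x in nhds τ, Φ x ∈ S) ∧ Module.finrank ℝ (LinearMap.range (Φ' : E →ₗ[ℝ] 𝔸)) = d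

theorem krener {𝔸 : Type} [NormedRing 𝔸] [NormedAlgebra ℝ 𝔸] [FiniteDimensional ℝ 𝔸]
    (S : Submonoid 𝔸) (hunit : ∀ s ∈ S, IsUnit s) (X : Set 𝔸)
    (hX : ∀ x ∈ X, ∀ t : ℝ, 0 ≤ t → NormedSpace.exp (t • x) ∈ S) :
    ∃ (W : Submodule ℝ 𝔸) (p : 𝔸), p ∈ S ∧ (∀ g ∈ S, ∀ x ∈ X, ∃ w ∈ W, x * g = g * w) ∧
      ∀ K : Submodule ℝ 𝔸, W ⊔ K = ⊤ → ∀ N ∈ nhds (0 : 𝔸),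
        ∀ᶠ a in nhds p, ∃ s ∈ S, ∃ Y ∈ K, Y ∈ N ∧ a = (1 + Y) * s := by
  have : CompleteSpace 𝔸 := FiniteDimensional.complete ℝ 𝔸
  -- choose a maximal rank
  obtain ⟨d, hd, hmax⟩ : ∃ d, KrenerRank S d ∧ ∀ d', KrenerRank S d' → d' ≤ d := by
    have hne : {d | KrenerRank S d}.Nonempty :=
      ⟨_, ℝ, inferInstance, inferInstance, inferInstance, fun _ => 1, 0, 0,
        hasStrictFDerivAt_const _ _, Filter.Eventually.of_forall fun _ => S.one_mem, rfl⟩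
    have hb : BddAbove {d | KrenerRank S d} := by
      refine ⟨Module.finrank ℝ 𝔸, ?_⟩
      rintro d ⟨E, _, _, _, Φ, τ, Φ', _, _, rfl⟩
      exact Submodule.finrank_le _
    exact ⟨sSup {d | KrenerRank S d}, Nat.sSup_mem hne hb, fun d' h => le_csSup hb h⟩
  obtain ⟨E, _, _, _, Φ, τ, Φ', hΦ, hS, hrank⟩ := hd
  set p := Φ τ with hp
  have hpS : p ∈ S := hS.self_of_nhds
  set R := LinearMap.range (Φ' : E →ₗ[ℝ] 𝔸) with hR
  -- the key maximality property
  have key : ∀ g ∈ S, ∀ x ∈ X, ∃ r ∈ R, x * g * p = g * r := by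
    intro g hg x hx
    set e := NormedSpace.exp ((1 : ℝ) • x) with he
    have heS : e ∈ S := hX x hx 1 zero_le_one
    obtain ⟨v, hv⟩ := hunit (e * g) (S.mul_mem heS hg)
    have hexp : HasStrictDerivAt (fun s : ℝ => NormedSpace.exp (s • x)) (x * e) 1 :=
      hasStrictDerivAt_exp_smul_const' (𝕂 := ℝ) x 1
    have h1 : HasStrictFDerivAt (fun q : E × ℝ => NormedSpace.exp (q.2 • x)) _ (τ, (1:ℝ)) :=
      HasStrictFDerivAt.comp (f := fun q : E × ℝ => q.2) (τ, (1:ℝ)) hexp.hasStrictFDerivAt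
        hasStrictFDerivAt_snd
    have h2 : HasStrictFDerivAt (fun q : E × ℝ => g * Φ q.1) _ (τ, (1:ℝ)) :=
      (HasStrictFDerivAt.comp (f := fun q : E × ℝ => q.1) (τ, (1:ℝ)) hΦ
        hasStrictFDerivAt_fst).const_mul g
    have h3 := h1.mul' h2
    have h4 := hmax _ ⟨E × ℝ, inferInstance, inferInstance, inferInstance, _, _, _, h3, ?_, rfl⟩
    · -- compare ranks
      set D := LinearMap.range (_ : E × ℝ →ₗ[ℝ] 𝔸) with hD
      let m : 𝔸 →ₗ[ℝ] 𝔸 := LinearMap.mulLeft ℝ (e * g)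
      have hm : Function.Injective m := by
        intro a b hab
        have : (e * g) * a = (e * g) * b := hab
        rw [← hv] at this
        exact v.mul_right_inj.1 this
      have hle : R.map m ≤ D := by
        rintro _ ⟨_, ⟨y, rfl⟩, rfl⟩
        refine ⟨(y, 0), ?_⟩
        simp [m, he]
      have hfr : Module.finrank ℝ (R.map m) = d := by
        rw [← hrank]
        exact (LinearEquiv.finrank_eq (Submodule.equivMapOfInjective m hm R)).symm
      have heq : R.map m = D := Submodule.eq_of_le_of_finrank_le hle (by rw [hfr]; exact h4)
      have hmem : (x * e) * (g * p) ∈ D := by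
        refine ⟨(0, 1), ?_⟩
        simp [hp]
      rw [← heq] at hmem
      obtain ⟨r, hr, hr'⟩ := hmem
      refine ⟨r, hr, ?_⟩
      have hc : x * e = e * x := by
        have : Commute x e := by
          rw [he, one_smul]
          exact (Commute.refl x).exp_right
        exact this
      have hr2 : (e * g) * r = (x * e) * (g * p) := hr'
      rw [hc] at hr2
      obtain ⟨w, hw⟩ := hunit e heS
      rw [← hw] at hr2
      have : (w : 𝔸) * (g * r) = w * (x * g * p) := by
        rw [← mul_assoc, hr2]; simp only [mul_assoc]
      exact (w.mul_right_inj.1 this).symm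
    · have t1 : Filter.Tendsto (fun q : E × ℝ => q.1) (nhds (τ, (1:ℝ))) (nhds τ) :=
        continuous_fst.tendsto _
      have t2 : Filter.Tendsto (fun q : E × ℝ => q.2) (nhds (τ, (1:ℝ))) (nhds 1) :=
        continuous_snd.tendsto _
      filter_upwards [t1.eventually hS, t2.eventually (lt_mem_nhds zero_lt_one)] with q hq1 hq2
      exact S.mul_mem (hX x hx _ hq2.le) (S.mul_mem hg hq1)
  obtain ⟨P, hP⟩ := hunit p hpS
  refine ⟨R.map (LinearMap.mulRight ℝ (↑P⁻¹ : 𝔸)), p, hpS, ?_, ?_⟩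
  · intro g hg x hx
    obtain ⟨r, hr, h⟩ := key g hg x hx
    refine ⟨r * ↑P⁻¹, ⟨r, hr, rfl⟩, ?_⟩
    rw [← mul_assoc, ← h, ← hP, Units.mul_inv_cancel_right]
  · intro K hK N hN
    have h1 : HasStrictFDerivAt (fun q : E × K => (1 : 𝔸) + q.2) (K.subtypeL.comp (ContinuousLinearMap.snd ℝ E K)) (τ, (0 : K)) :=
      ((K.subtypeL.comp (ContinuousLinearMap.snd ℝ E K)).hasStrictFDerivAt).const_add 1
    have h2 : HasStrictFDerivAt (fun q : E × K => Φ q.1) _ (τ, (0 : K)) :=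
      (HasStrictFDerivAt.comp (f := fun q : E × K => q.1) (τ, (0 : K)) hΦ hasStrictFDerivAt_fst)
    have h3 := h1.mul' h2
    have hsurj : ∀ a : 𝔸, ∃ y : E, ∃ k : K, Φ' y + k * p = a := by
      intro a
      have : a * ↑P⁻¹ ∈ (⊤ : Submodule ℝ 𝔸) := trivial
      rw [← hK, Submodule.mem_sup] at this
      obtain ⟨_, ⟨_, ⟨y, rfl⟩, rfl⟩, k, hk, hsum⟩ := this
      refine ⟨y, ⟨k, hk⟩, ?_⟩
      have : a = (a * ↑P⁻¹) * P := by rw [Units.inv_mul_cancel_right]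
      rw [this, ← hsum, add_mul, ← hP]
      simp
    have hmap := h3.map_nhds_eq_of_surj (by
      rw [LinearMap.range_eq_top]
      intro a
      obtain ⟨y, k, hyk⟩ := hsurj a
      refine ⟨(y, k), ?_⟩
      simpa [hp] using hyk)
    have hmap : Filter.map (fun q : E × K => ((1 : 𝔸) + q.2) * Φ q.1) (nhds (τ, (0 : K))) = nhds p := by
      have e : ((1 : 𝔸) + ((0 : K) : 𝔸)) * Φ τ = p := by simp [hp]
      rw [← e]
      exact hmap
    rw [← hmap, Filter.eventually_map]
    have t1 : Filter.Tendsto (fun q : E × K => q.1) (nhds (τ, (0:K))) (nhds τ) :=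
      continuous_fst.tendsto _
    have t2 : Filter.Tendsto (fun q : E × K => (q.2 : 𝔸)) (nhds (τ, (0:K))) (nhds 0) :=
      (continuous_subtype_val.comp continuous_snd).tendsto' _ _ (by simp)
    filter_upwards [t1.eventually hS, t2.eventually hN] with q hq1 hq2
    exact ⟨Φ q.1, hq1, q.2, q.2.2, hq2, rfl⟩

theorem perm_span {n : ℕ} (W : Submodule ℝ (Fin n → ℝ)) (l : Fin n → ℝ) {j k : Fin n}
    (hjk : l j ≠ l k) (h : ∀ σ : Equiv.Perm (Fin n), l ∘ σ ∈ W) (μ : Fin n → ℝ)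
    (hμ : ∑ i, μ i = 0) : μ ∈ W := by
  have hjk' : j ≠ k := fun h => hjk (by rw [h])
  have key : ∀ a b : Fin n, (Pi.single a (1 : ℝ) - Pi.single b 1 : Fin n → ℝ) ∈ W := by
    intro a b
    by_cases hab : a = b
    · rw [hab, sub_self]; exact W.zero_mem
    obtain ⟨σ, hσa, hσb⟩ : ∃ σ : Equiv.Perm (Fin n), σ a = j ∧ σ b = k := by
      refine ⟨Equiv.swap (Equiv.swap a j b) k * Equiv.swap a j, ?_, ?_⟩
      · rw [Equiv.Perm.mul_apply, Equiv.swap_apply_left]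
        refine Equiv.swap_apply_of_ne_of_ne ?_ hjk'
        intro h
        have : Equiv.swap a j a = Equiv.swap a j b := by rw [Equiv.swap_apply_left]; exact h
        exact hab ((Equiv.swap a j).injective this)
      · rw [Equiv.Perm.mul_apply, Equiv.swap_apply_left]
    have h1 := W.sub_mem (h σ) (h (σ * Equiv.swap a b))
    have h2 := W.smul_mem (l j - l k)⁻¹ h1
    convert h2 using 1
    have h0 : l j - l k ≠ 0 := sub_ne_zero.2 hjk
    ext i
    simp only [Pi.sub_apply, Pi.smul_apply, Function.comp, Equiv.Perm.mul_apply, smul_eq_mul]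
    by_cases hia : i = a
    · subst hia
      rw [Equiv.swap_apply_left, hσa, hσb, Pi.single_eq_same, Pi.single_eq_of_ne hab]
      field_simp
      ring
    · by_cases hib : i = b
      · subst hib
        rw [Equiv.swap_apply_right, hσa, hσb, Pi.single_eq_same, Pi.single_eq_of_ne hia]
        field_simp
        ring
      · rw [Equiv.swap_apply_of_ne_of_ne hia hib, Pi.single_eq_of_ne hia, Pi.single_eq_of_ne hib]
        simp
  have hs : μ = ∑ a, μ a • (Pi.single a (1 : ℝ) - Pi.single j 1 : Fin n → ℝ) := by
    simp only [smul_sub, Finset.sum_sub_distrib, ← Finset.sum_smul, hμ, zero_smul, sub_zero]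
    ext i
    simp [Finset.sum_apply, Pi.single_apply]
  rw [hs]
  exact W.sum_mem fun a _ => W.smul_mem _ (key a j)

theorem herm_diag {n : ℕ} {H : Matrix (Fin n) (Fin n) ℂ} (hH : H.IsHermitian) :
    ∃ V ∈ Matrix.unitaryGroup (Fin n) ℂ, ∃ l : Fin n → ℝ,
      H = V * Matrix.diagonal (fun i => (l i : ℂ)) * star V := by
  refine ⟨_, hH.eigenvectorUnitary.2, hH.eigenvalues, ?_⟩
  have := hH.spectral_theorem
  rw [Unitary.conjStarAlgAut_apply] at this
  exact this

theorem herm_span {n : ℕ} (W : Submodule ℝ (Matrix (Fin n) (Fin n) ℂ))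
    {H : Matrix (Fin n) (Fin n) ℂ} (hH : H.IsHermitian) (htr : H.trace = 0) (hne : H ≠ 0)
    (hW : ∀ g ∈ Matrix.unitaryGroup (Fin n) ℂ, star g * H * g ∈ W)
    {A : Matrix (Fin n) (Fin n) ℂ} (hA : A.IsHermitian) (htrA : A.trace = 0) : A ∈ W := by
  obtain ⟨V, hV, l, hl⟩ := herm_diag hH
  obtain ⟨Q, hQ, μ, hμ⟩ := herm_diag hA
  have hV1 : star V * V = 1 := (Matrix.mem_unitaryGroup_iff').1 hV
  have hQ1 : star Q * Q = 1 := (Matrix.mem_unitaryGroup_iff').1 hQ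
  have trl : ∑ i, l i = 0 := by
    rw [hl, mul_assoc, Matrix.trace_mul_comm, mul_assoc, hV1, mul_one, Matrix.trace_diagonal] at htr
    exact_mod_cast htr
  have trμ : ∑ i, μ i = 0 := by
    rw [hμ, mul_assoc, Matrix.trace_mul_comm, mul_assoc, hQ1, mul_one,
      Matrix.trace_diagonal] at htrA
    exact_mod_cast htrA
  obtain ⟨j, k, hjk⟩ : ∃ j k, l j ≠ l k := by
    by_contra! hcon
    apply hne
    have : l = 0 := by
      ext i
      have h1 : ∑ i', l i' = ∑ _i' : Fin n, l i := Finset.sum_congr rfl fun i' _ => hcon i' i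
      rw [trl, Finset.sum_const, Finset.card_univ, Fintype.card_fin, nsmul_eq_mul] at h1
      have hn : (n : ℝ) ≠ 0 := by
        have := i.pos
        positivity
      simpa [hn] using h1.symm
    rw [hl, this]
    simp
  let f : (Fin n → ℝ) →ₗ[ℝ] Matrix (Fin n) (Fin n) ℂ :=
    { toFun := fun d => Q * Matrix.diagonal (fun i => (d i : ℂ)) * star Q
      map_add' := by
        intro x y
        have : Matrix.diagonal (fun i => (((x + y) i : ℝ) : ℂ)) =
            Matrix.diagonal (fun i => (x i : ℂ)) + Matrix.diagonal (fun i => (y i : ℂ)) := by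
          rw [Matrix.diagonal_add]; simp
        rw [this, mul_add, add_mul]
      map_smul' := by
        intro c x
        have : Matrix.diagonal (fun i => (((c • x) i : ℝ) : ℂ)) =
            c • Matrix.diagonal (fun i => (x i : ℂ)) := by
          rw [← Matrix.diagonal_smul]
          congr 1
          ext i
          simp
        rw [this, mul_smul_comm, smul_mul_assoc]
        rfl }
  have hf : ∀ d, f d = Q * Matrix.diagonal (fun i => (d i : ℂ)) * star Q := fun _ => rfl
  have hmem : μ ∈ W.comap f := by
    refine perm_span (W.comap f) l hjk ?_ μ trμ
    intro σ
    rw [Submodule.mem_comap, hf]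
    set P : Matrix (Fin n) (Fin n) ℂ := (σ.permMatrix ℂ) with hP
    have hPP : star P * P = 1 := by
      rw [hP, Matrix.star_eq_conjTranspose, Matrix.conjTranspose_permMatrix,
        ← Matrix.permMatrix_mul]
      simp
    have hPU : P ∈ Matrix.unitaryGroup (Fin n) ℂ := (Matrix.mem_unitaryGroup_iff').2 hPP
    have hd : Matrix.diagonal (fun i => ((l ∘ σ) i : ℂ)) =
        P * Matrix.diagonal (fun i => (l i : ℂ)) * star P := by
      rw [hP, Matrix.star_eq_conjTranspose, Matrix.conjTranspose_permMatrix]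
      rw [PEquiv.toMatrix_toPEquiv_mul, PEquiv.mul_toMatrix_toPEquiv]
      ext a b
      have : (Equiv.symm σ⁻¹) = σ := rfl
      simp [Matrix.diagonal_apply, this]
    have := hW (V * star P * star Q) (mul_mem (mul_mem hV (Unitary.star_mem hPU))
      (Unitary.star_mem hQ))
    have e : star (V * star P * star Q) * H * (V * star P * star Q) =
        Q * (P * Matrix.diagonal (fun i => (l i : ℂ)) * star P) * star Q := by
      rw [hl]
      simp only [star_mul, star_star]
      calc _ = Q * (P * (star V * V) * Matrix.diagonal (fun i => (l i : ℂ)) *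
            (star V * V) * star P) * star Q := by simp only [mul_assoc]
        _ = _ := by rw [hV1]; simp only [mul_one]
    rw [hd, ← e]
    exact this
  rw [hμ]
  exact hmem

theorem unitary_phase {n : ℕ} (hn : n ≠ 0) {g : Matrix (Fin n) (Fin n) ℂ}
    (hg : g ∈ Matrix.unitaryGroup (Fin n) ℂ) :
    ∃ z : ℂ, star z * z = 1 ∧ z • g ∈ Matrix.specialUnitaryGroup (Fin n) ℂ := by
  have h1 : g.det ∈ unitary ℂ := Matrix.det_of_mem_unitary hg
  have h2 : ‖g.det‖ = 1 := by
    have := (Unitary.mem_iff.1 h1).1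
    exact CStarRing.norm_of_mem_unitary h1
  obtain ⟨z, hz⟩ := IsAlgClosed.exists_pow_nat_eq (star g.det) (Nat.pos_of_ne_zero hn)
  have hz1 : ‖z‖ = 1 := by
    have : ‖z‖ ^ n = 1 := by rw [← norm_pow, hz, norm_star, h2]
    exact (pow_eq_one_iff_of_nonneg (norm_nonneg z) hn).1 this
  have hzz : star z * z = 1 := by
    have := Complex.conj_mul' z
    rw [hz1] at this
    simpa using this
  refine ⟨z, hzz, Matrix.mem_specialUnitaryGroup_iff.2 ⟨?_, ?_⟩⟩
  · rw [Matrix.mem_unitaryGroup_iff', star_smul, smul_mul_smul_comm, hzz,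
      (Matrix.mem_unitaryGroup_iff').1 hg, one_smul]
  · rw [Matrix.det_smul, Fintype.card_fin, hz]
    exact (Unitary.mem_iff.1 h1).1

theorem dense_monoid {𝔸 : Type} [NormedRing 𝔸] [NormedAlgebra ℝ 𝔸] [FiniteDimensional ℝ 𝔸]
    (S G : Submonoid 𝔸) (X : Set 𝔸) (ι : 𝔸 → 𝔸) (hι : Continuous ι)
    (hιG : ∀ g ∈ G, ι g ∈ G) (h1 : ∀ g ∈ G, g * ι g = 1) (h2 : ∀ g ∈ G, ι g * g = 1)
    (hSG : ∀ s ∈ S, s ∈ G) (hGS : (G : Set 𝔸) ⊆ closure (S : Set 𝔸))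
    (hX : ∀ x ∈ X, ∀ t : ℝ, 0 ≤ t → NormedSpace.exp (t • x) ∈ S)
    (hK : ∀ W : Submodule ℝ 𝔸, (∀ g ∈ G, ∀ x ∈ X, ι g * x * g ∈ W) →
      ∃ K : Submodule ℝ 𝔸, W ⊔ K = ⊤ ∧ ∃ N ∈ nhds (0 : 𝔸), ∀ Y ∈ K, Y ∈ N → 1 + Y ∈ G → Y = 0) :
    ∀ g ∈ G, g ∈ S := by
  obtain ⟨W, p, hp, hW, hkey⟩ := krener S
    (fun s hs => ⟨⟨s, ι s, h1 s (hSG s hs), h2 s (hSG s hs)⟩, rfl⟩) X hX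
  have hWG : ∀ g ∈ G, ∀ x ∈ X, ι g * x * g ∈ W := by
    intro g hg x hx
    have hcl : IsClosed {a : 𝔸 | ι a * x * a ∈ W} := by
      have hWc : IsClosed (W : Set 𝔸) := W.closed_of_finiteDimensional
      exact hWc.preimage ((hι.mul continuous_const).mul continuous_id)
    refine closure_minimal ?_ hcl (hGS hg)
    intro s hs
    obtain ⟨w, hw, hxw⟩ := hW s hs x hx
    change ι s * x * s ∈ W
    rw [mul_assoc, hxw, ← mul_assoc, h2 s (hSG s hs), one_mul]
    exact hw
  obtain ⟨K, hWK, N, hN, hNK⟩ := hK W hWG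
  have hnear := hkey K hWK N hN
  have hnear' : ∀ᶠ a in nhds p, a ∈ G → a ∈ S := by
    filter_upwards [hnear] with a ha haG
    obtain ⟨s, hs, Y, hYK, hYN, rfl⟩ := ha
    have : 1 + Y ∈ G := by
      have := G.mul_mem haG (hιG s (hSG s hs))
      rwa [mul_assoc, h1 s (hSG s hs), mul_one] at this
    rw [hNK Y hYK hYN this, add_zero, one_mul]
    exact hs
  intro g hg
  have hpG := hSG p hp
  have hq : g * ι p ∈ G := G.mul_mem hg (hιG p hpG)
  have hqι : ι (g * ι p) * g = p := by
    have e : g = (g * ι p) * p := by rw [mul_assoc, h2 p hpG, mul_one]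
    calc ι (g * ι p) * g = ι (g * ι p) * ((g * ι p) * p) := by rw [← e]
      _ = p := by rw [← mul_assoc, h2 _ hq, one_mul]
  have ht : Filter.Tendsto (fun a => ι a * g) (nhds (g * ι p)) (nhds p) :=
    (hι.mul continuous_const).tendsto' _ _ hqι
  obtain ⟨s, hs, hsS⟩ := (mem_closure_iff_frequently.1 (hGS hq)).and_eventually
    (ht.eventually hnear') |>.exists
  have h4 := hsS (G.mul_mem (hιG s (hSG s hs)) hg)
  have : g = s * (ι s * g) := by rw [← mul_assoc, h1 s (hSG s hs), one_mul]
  rw [this]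
  exact S.mul_mem hs h4

theorem rigid_near {n : ℕ} (i0 : Fin n) :
    ∀ᶠ Y in @nhds _ instTopologicalSpaceMatrix (0 : Matrix (Fin n) (Fin n) ℂ),
      ∀ P : Matrix (Fin n) (Fin n) ℂ, ∀ c : ℝ, P.IsHermitian →
        Y = P + c • (Complex.I • (1 : Matrix (Fin n) (Fin n) ℂ)) →
        1 + Y ∈ Matrix.specialUnitaryGroup (Fin n) ℂ → Y = 0 := by
  let F : Matrix (Fin n) (Fin n) ℂ → Matrix (Fin n) (Fin n) ℂ := fun Y =>
    1 + (Y - (Y i0 i0).im • (Complex.I • (1 : Matrix (Fin n) (Fin n) ℂ))) +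
      (Real.sqrt (1 - (Y i0 i0).im ^ 2)) • (1 : Matrix (Fin n) (Fin n) ℂ)
  have hF : @Continuous _ _ instTopologicalSpaceMatrix instTopologicalSpaceMatrix F := by
    refine continuous_pi fun a => continuous_pi fun b => ?_
    simp only [F, Matrix.add_apply, Matrix.sub_apply, Matrix.smul_apply]
    have : ∀ a b : Fin n, @Continuous _ _ instTopologicalSpaceMatrix _
      (fun Y : Matrix (Fin n) (Fin n) ℂ => Y a b) := fun a b =>
        (continuous_apply b).comp (continuous_apply a)
    have h1 := this a b
    have h2 := Complex.continuous_im.comp (this i0 i0)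
    have h3 : Continuous fun r : ℝ => Real.sqrt (1 - r ^ 2) := by fun_prop
    have h4 := h3.comp h2
    exact (continuous_const.add (h1.sub (h2.smul continuous_const))).add
      (h4.smul continuous_const)
  have e1 : ∀ᶠ Y in @nhds _ instTopologicalSpaceMatrix (0 : Matrix (Fin n) (Fin n) ℂ),
      (F Y).det ≠ 0 := by
    have : @Continuous _ _ instTopologicalSpaceMatrix _ (fun Y => (F Y).det) :=
      Continuous.matrix_det hF
    refine this.continuousAt.eventually_ne ?_
    have : F 0 = (2 : ℂ) • (1 : Matrix (Fin n) (Fin n) ℂ) := by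
      simp [F, two_smul]
    rw [this, Matrix.det_smul]
    simp
  have e2 : ∀ᶠ Y in @nhds _ instTopologicalSpaceMatrix (0 : Matrix (Fin n) (Fin n) ℂ),
      ∑ k ∈ Finset.range n, (1 + Y i0 i0) ^ k ≠ 0 := by
    have : @Continuous _ _ instTopologicalSpaceMatrix _
        (fun Y : Matrix (Fin n) (Fin n) ℂ => ∑ k ∈ Finset.range n, (1 + Y i0 i0) ^ k) := by
      have : @Continuous _ _ instTopologicalSpaceMatrix _
        (fun Y : Matrix (Fin n) (Fin n) ℂ => Y i0 i0) := 
        (continuous_apply i0).comp (continuous_apply i0)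
      fun_prop
    refine this.continuousAt.eventually_ne ?_
    simp [i0.pos.ne']
  have e3 : ∀ᶠ Y in @nhds _ instTopologicalSpaceMatrix (0 : Matrix (Fin n) (Fin n) ℂ),
      (Y i0 i0).im ^ 2 < 1 := by
    have : @Continuous _ _ instTopologicalSpaceMatrix _
        (fun Y : Matrix (Fin n) (Fin n) ℂ => (Y i0 i0).im ^ 2) := by
      have : @Continuous _ _ instTopologicalSpaceMatrix _
        (fun Y : Matrix (Fin n) (Fin n) ℂ => Y i0 i0) := 
        (continuous_apply i0).comp (continuous_apply i0)
      fun_prop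
    exact this.continuousAt.eventually_lt_const (by simp)
  filter_upwards [e1, e2, e3] with Y hY1 hY2 hY3 P c hP hY hSU
  have hc : (Y i0 i0).im = c := by
    have : (P i0 i0).im = 0 := by
      have := congrFun (congrFun hP i0) i0
      rw [Matrix.conjTranspose_apply] at this
      exact Complex.conj_eq_iff_im.1 this
    rw [hY]
    simp [this]
  obtain ⟨hun, hdet⟩ := Matrix.mem_specialUnitaryGroup_iff.1 hSU
  have hYP : Y - c • (Complex.I • (1 : Matrix (Fin n) (Fin n) ℂ)) = P := by rw [hY]; simp
  simp only [F, hc, hYP] at hY1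
  rw [hc] at hY3
  set s := Real.sqrt (1 - c ^ 2) with hs
  have hs2 : s * s = 1 - c * c := by
    rw [hs, Real.mul_self_sqrt (by linarith)]; ring
  have hstar : star (1 + Y) = 1 + P - c • (Complex.I • (1 : Matrix (Fin n) (Fin n) ℂ)) := by
    rw [hY]
    have : star P = P := hP
    simp only [star_add, star_one, this, star_smul, star_trivial]
    simp [sub_eq_add_neg, add_assoc]
  have hmul := Matrix.mem_unitaryGroup_iff.1 hun
  rw [hstar, hY] at hmul
  have hprod : (1 + P - s • (1 : Matrix (Fin n) (Fin n) ℂ)) *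
      (1 + P + s • (1 : Matrix (Fin n) (Fin n) ℂ)) = 0 := by
    have hI : (Complex.I • (1 : Matrix (Fin n) (Fin n) ℂ)) *
        (Complex.I • (1 : Matrix (Fin n) (Fin n) ℂ)) = -1 := by
      rw [smul_mul_smul_comm, Complex.I_mul_I, neg_one_smul, mul_one]
    have hJ : ∀ Q : Matrix (Fin n) (Fin n) ℂ, (Complex.I • (1 : Matrix (Fin n) (Fin n) ℂ)) * Q =
        Q * (Complex.I • (1 : Matrix (Fin n) (Fin n) ℂ)) := by
      intro Q; simp
    have e1 : (1 + (P + c • (Complex.I • (1 : Matrix (Fin n) (Fin n) ℂ)))) *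
      (1 + P - c • (Complex.I • (1 : Matrix (Fin n) (Fin n) ℂ))) =
        (1 + P) * (1 + P) + (c * c) • (1 : Matrix (Fin n) (Fin n) ℂ) := by
      rw [← add_assoc]
      revert hI hJ
      generalize 1 + P = Q
      generalize (Complex.I • (1 : Matrix (Fin n) (Fin n) ℂ)) = J
      intro hI hJ
      simp only [add_mul, mul_sub, mul_smul_comm, smul_mul_assoc, hI, hJ]
      module
    rw [e1] at hmul
    have e2 : (1 + P - s • (1 : Matrix (Fin n) (Fin n) ℂ)) *
      (1 + P + s • (1 : Matrix (Fin n) (Fin n) ℂ)) = (1 + P) * (1 + P) - (s * s) • (1 : Matrix (Fin n) (Fin n) ℂ) := by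
      generalize 1 + P = Q
      simp only [sub_mul, mul_add, mul_smul_comm, smul_mul_assoc, mul_one, one_mul]
      module
    rw [e2, hs2, eq_sub_of_add_eq hmul]
    module
  have hQ : 1 + P - s • (1 : Matrix (Fin n) (Fin n) ℂ) = 0 := by
    have hu : IsUnit (1 + P + s • (1 : Matrix (Fin n) (Fin n) ℂ)) :=
      (Matrix.isUnit_iff_isUnit_det _).2 (isUnit_iff_ne_zero.2 hY1)
    exact hu.mul_left_eq_zero.1 hprod
  have hz : 1 + Y = ((s : ℂ) + c * Complex.I) • (1 : Matrix (Fin n) (Fin n) ℂ) := by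
    rw [hY, ← add_assoc, sub_eq_zero.1 hQ]
    ext a b
    simp [add_mul, mul_assoc]
  have hz0 : 1 + Y i0 i0 = (s : ℂ) + c * Complex.I := by
    have := congrFun (congrFun hz i0) i0
    simpa using this
  rw [← hz0] at hz
  rw [hz, Matrix.det_smul, Matrix.det_one, mul_one, Fintype.card_fin] at hdet
  have hg := geom_sum_mul (1 + Y i0 i0) n
  rw [hdet, sub_self] at hg
  have h1 := (mul_eq_zero.1 hg).resolve_left hY2
  have h2 : 1 + Y i0 i0 = 1 := by linear_combination h1
  rw [h2, one_smul] at hz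
  simpa using hz

theorem matrix_sup_compl {n : ℕ} (hn : n ≠ 0) (W : Submodule ℝ (Matrix (Fin n) (Fin n) ℂ))
    (hW : ∀ A : Matrix (Fin n) (Fin n) ℂ, A.IsHermitian → A.trace = 0 → (-Complex.I) • A ∈ W) :
    W ⊔ (selfAdjoint.submodule ℝ (Matrix (Fin n) (Fin n) ℂ) ⊔
      Submodule.span ℝ {Complex.I • (1 : Matrix (Fin n) (Fin n) ℂ)}) = ⊤ := by
  rw [eq_top_iff]
  intro a _
  have hn' : (n : ℂ) ≠ 0 := by exact_mod_cast hn
  let B : Matrix (Fin n) (Fin n) ℂ := (Complex.I / 2) • (a - star a)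
  have hB : B.IsHermitian := by
    change star B = B
    simp only [B, star_smul, star_sub, star_star]
    have : star (Complex.I / 2) = -(Complex.I / 2) := by
      simp [neg_div]
    rw [this]
    module
  let P : Matrix (Fin n) (Fin n) ℂ := (1 / 2 : ℂ) • (a + star a)
  have hP : star P = P := by
    simp only [P, star_smul, star_add, star_star]
    have : star (1 / 2 : ℂ) = 1 / 2 := by simp
    rw [this, add_comm]
  have htr : ((B.trace.re : ℝ) : ℂ) = B.trace := by
    have : star B.trace = B.trace := by
      rw [← Matrix.trace_conjTranspose, hB.eq]
    exact Complex.conj_eq_iff_re.1 this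
  set t : ℝ := B.trace.re / n with ht
  let A : Matrix (Fin n) (Fin n) ℂ := B - (t : ℂ) • 1
  have hA : A.IsHermitian := by
    change star A = A
    have : star B = B := hB
    simp [A, this]
  have hA0 : A.trace = 0 := by
    simp only [A, Matrix.trace_sub, Matrix.trace_smul, Matrix.trace_one, Fintype.card_fin,
      smul_eq_mul, ht]
    push_cast
    rw [htr]
    field_simp
    simp
  refine Submodule.mem_sup.2 ⟨_, hW A hA hA0, _, Submodule.mem_sup.2 ⟨P, hP, _,
    Submodule.mem_span_singleton.2 ⟨-t, rfl⟩, rfl⟩, ?_⟩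
  have : ((-t) • Complex.I • (1 : Matrix (Fin n) (Fin n) ℂ)) =
    (-(t : ℂ)) • Complex.I • (1 : Matrix (Fin n) (Fin n) ℂ) := by
    ext i j; simp
  rw [this]
  simp only [A, B, P, smul_sub, smul_smul, smul_add]
  have h2 : -Complex.I * (Complex.I / 2) = 1 / 2 := by
    linear_combination (-1 / 2) * Complex.I_mul_I
  rw [h2]
  module

theorem su_of_dense {n : ℕ} (hn : 2 ≤ n) (S : Submonoid (Matrix (Fin n) (Fin n) ℂ))
    (hSG : ∀ s ∈ S, s ∈ Matrix.specialUnitaryGroup (Fin n) ℂ)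
    (hGS : (Matrix.specialUnitaryGroup (Fin n) ℂ : Set (Matrix (Fin n) (Fin n) ℂ)) ⊆
      @closure _ instTopologicalSpaceMatrix (S : Set (Matrix (Fin n) (Fin n) ℂ)))
    (H : Matrix (Fin n) (Fin n) ℂ) (hH : H.IsHermitian) (htr : H.trace = 0) (hne : H ≠ 0)
    (hX : ∀ t : ℝ, 0 ≤ t → NormedSpace.exp (t • ((-Complex.I) • H)) ∈ S) :
    ∀ g ∈ Matrix.specialUnitaryGroup (Fin n) ℂ, g ∈ S := by
  have hn0 : n ≠ 0 := by omega
  have hinv : ∀ g ∈ Matrix.specialUnitaryGroup (Fin n) ℂ, g * star g = 1 := fun g hg =>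
    Matrix.mem_unitaryGroup_iff.1 (Matrix.mem_specialUnitaryGroup_iff.1 hg).1
  have hinv' : ∀ g ∈ Matrix.specialUnitaryGroup (Fin n) ℂ, star g * g = 1 := fun g hg =>
    Matrix.mem_unitaryGroup_iff'.1 (Matrix.mem_specialUnitaryGroup_iff.1 hg).1
  have hstar : ∀ g ∈ Matrix.specialUnitaryGroup (Fin n) ℂ,
      star g ∈ Matrix.specialUnitaryGroup (Fin n) ℂ := fun g hg => by
    obtain ⟨h1, h2⟩ := Matrix.mem_specialUnitaryGroup_iff.1 hg
    refine Matrix.mem_specialUnitaryGroup_iff.2 ⟨Unitary.star_mem h1, ?_⟩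
    rw [Matrix.star_eq_conjTranspose, Matrix.det_conjTranspose, h2, star_one]
  have hcont : @Continuous _ _ instTopologicalSpaceMatrix instTopologicalSpaceMatrix
      (fun g : Matrix (Fin n) (Fin n) ℂ => star g) :=
    continuous_pi fun a => continuous_pi fun b =>
      continuous_star.comp ((continuous_apply a).comp (continuous_apply b))
  have hK : ∀ W : Submodule ℝ (Matrix (Fin n) (Fin n) ℂ),
      (∀ g ∈ Matrix.specialUnitaryGroup (Fin n) ℂ, ∀ x ∈ ({(-Complex.I) • H} : Set _),
        star g * x * g ∈ W) →
      ∃ K : Submodule ℝ (Matrix (Fin n) (Fin n) ℂ), W ⊔ K = ⊤ ∧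
        ∃ N ∈ @nhds _ instTopologicalSpaceMatrix (0 : Matrix (Fin n) (Fin n) ℂ),
          ∀ Y ∈ K, Y ∈ N → 1 + Y ∈ Matrix.specialUnitaryGroup (Fin n) ℂ → Y = 0 := by
    intro W hW
    refine ⟨_, matrix_sup_compl hn0 W ?_, _, rigid_near ⟨0, by omega⟩, ?_⟩
    · intro A hA hA0
      let f : Matrix (Fin n) (Fin n) ℂ →ₗ[ℝ] Matrix (Fin n) (Fin n) ℂ :=
        LinearMap.restrictScalars ℝ (LinearMap.lsmul ℂ (Matrix (Fin n) (Fin n) ℂ) (-Complex.I))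
      have hf : ∀ B, f B = (-Complex.I) • B := fun _ => rfl
      refine herm_span (W.comap f) hH htr hne ?_ hA hA0
      intro g hg
      obtain ⟨z, hz, hzg⟩ := unitary_phase hn0 hg
      have := hW _ hzg _ rfl
      rw [Submodule.mem_comap, hf]
      convert this using 1
      rw [star_smul, smul_mul_assoc, smul_mul_assoc, mul_smul_comm, smul_smul, hz, one_smul,
        mul_smul_comm, smul_mul_assoc]
    · intro Y hYK hYN hY
      obtain ⟨P, hP, _, hQ, hsum⟩ := Submodule.mem_sup.1 hYK
      obtain ⟨c, rfl⟩ := Submodule.mem_span_singleton.1 hQ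
      exact hYN P c hP hsum.symm hY
  letI i1 : NormedRing (Matrix (Fin n) (Fin n) ℂ) := Matrix.linftyOpNormedRing
  letI i2 : NormedAlgebra ℝ (Matrix (Fin n) (Fin n) ℂ) := Matrix.linftyOpNormedAlgebra
  have hX' : ∀ x ∈ ({(-Complex.I) • H} : Set (Matrix (Fin n) (Fin n) ℂ)), ∀ t : ℝ, 0 ≤ t →
      NormedSpace.exp (t • x) ∈ S := by
    rintro x rfl t ht
    exact hX t ht
  exact @dense_monoid (Matrix (Fin n) (Fin n) ℂ) i1 i2 inferInstance S
    (Matrix.specialUnitaryGroup (Fin n) ℂ) {(-Complex.I) • H} star hcont hstar hinv hinv' hSG hGS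
    hX' hK

theorem su_ne_one {n : ℕ} (hn : 2 ≤ n) :
    ∃ g ∈ Matrix.specialUnitaryGroup (Fin n) ℂ, g ≠ 1 := by
  let i0 : Fin n := ⟨0, by omega⟩
  let i1 : Fin n := ⟨1, by omega⟩
  have h01 : i1 ≠ i0 := by simp [i0, i1]
  let d : Fin n → ℂ := fun i => if i = i0 then -1 else 1
  have hd : Matrix.diagonal d ∈ Matrix.unitaryGroup (Fin n) ℂ := by
    rw [Matrix.mem_unitaryGroup_iff, Matrix.star_eq_conjTranspose, Matrix.diagonal_conjTranspose,
      Matrix.diagonal_mul_diagonal, ← Matrix.diagonal_one]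
    congr 1
    ext i
    by_cases h : i = i0 <;> simp [d, h]
  obtain ⟨z, -, hz⟩ := unitary_phase (by omega) hd
  refine ⟨_, hz, fun h => ?_⟩
  have h0 := congrFun (congrFun h i0) i0
  have h1 := congrFun (congrFun h i1) i1
  simp [d, h01] at h0 h1
  rw [h1] at h0
  norm_num at h0

theorem exists_ham_ne_zero {n m : ℕ} (hn : 2 ≤ n) {U : Set (EuclideanSpace ℝ (Fin m))}
    {Hmat : EuclideanSpace ℝ (Fin m) → Matrix (Fin n) (Fin n) ℂ}
    (h : (Matrix.specialUnitaryGroup (Fin n) ℂ : Set (Matrix (Fin n) (Fin n) ℂ)) ⊆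
      @closure _ instTopologicalSpaceMatrix (liftedReachable U Hmat 1)) :
    ∃ u ∈ U, Hmat u ≠ 0 := by
  by_contra! hcon
  obtain ⟨g, hg, hg1⟩ := su_ne_one hn
  have hsub : liftedReachable U Hmat 1 ⊆ {1} := by
    rintro _ ⟨T, hT, u, p, hu, hp, h0, rfl⟩
    have h3 := (traj_iff.1 hp).2.2 T ⟨hT, le_rfl⟩
    rw [Set.mem_singleton_iff, ← h0]
    ext i j
    rw [h3 i j, intervalIntegral.integral_congr (g := fun _ => 0)]
    · simp
    · intro s hs
      rw [Set.uIcc_of_le hT] at hs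
      simp [hcon _ (hu.2.1 s hs)]
  have hcl : @IsClosed _ instTopologicalSpaceMatrix ({1} : Set (Matrix (Fin n) (Fin n) ℂ)) := by
    exact isClosed_singleton (X := Fin n → Fin n → ℂ)
  have hmem := closure_minimal hsub hcl (h hg)
  exact hg1 hmem

/-- Theorem 4.1 of the paper, special unitary version. For a smooth
family of traceless Hermitian matrices `u ↦ H(u)`, the lifted system `i·ġ = H(u)·g`
leaves `SU(n)` invariant, and it is approximately controllable in `SU(n)` if and only
if it is exactly controllable in `SU(n)`. -/
theorem approx_iff_exact_controllability_special_unitary {n m : ℕ} (hn : 2 ≤ n)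
    (U : Set (EuclideanSpace ℝ (Fin m)))
    (Hmat : EuclideanSpace ℝ (Fin m) → Matrix (Fin n) (Fin n) ℂ)
    (hherm : ∀ u ∈ U, (Hmat u).IsHermitian)
    (htrace : ∀ u ∈ U, (Hmat u).trace = 0)
    (hsmooth : ContDiffOn ℝ (⊤ : ℕ∞) Hmat U) :
    (∀ (T : ℝ) (u : ℝ → EuclideanSpace ℝ (Fin m)) (g : ℝ → Matrix (Fin n) (Fin n) ℂ),
      0 ≤ T → IsAdmissibleControl U T u → IsLiftedTrajectory Hmat T u g →
      g 0 ∈ Matrix.specialUnitaryGroup (Fin n) ℂ →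
      ∀ t ∈ Set.Icc 0 T, g t ∈ Matrix.specialUnitaryGroup (Fin n) ℂ) ∧
    ((∀ g0 ∈ Matrix.specialUnitaryGroup (Fin n) ℂ,
      (Matrix.specialUnitaryGroup (Fin n) ℂ : Set (Matrix (Fin n) (Fin n) ℂ)) ⊆
        closure (liftedReachable U Hmat g0)) ↔
    (∀ g0 ∈ Matrix.specialUnitaryGroup (Fin n) ℂ,
      liftedReachable U Hmat g0 =
        (Matrix.specialUnitaryGroup (Fin n) ℂ : Set (Matrix (Fin n) (Fin n) ℂ)))) := by
  have part1 : ∀ (T : ℝ) (u : ℝ → EuclideanSpace ℝ (Fin m))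
      (g : ℝ → Matrix (Fin n) (Fin n) ℂ),
      0 ≤ T → IsAdmissibleControl U T u → IsLiftedTrajectory Hmat T u g →
      g 0 ∈ Matrix.specialUnitaryGroup (Fin n) ℂ →
      ∀ t ∈ Set.Icc 0 T, g t ∈ Matrix.specialUnitaryGroup (Fin n) ℂ := by
    intro T u g hT hu hg h0 t ht
    refine Matrix.mem_specialUnitaryGroup_iff.2 ⟨hg.1 t ht, ?_⟩
    rw [traj_det htrace hT hu hg t ht]
    exact (Matrix.mem_specialUnitaryGroup_iff.1 h0).2
  have hsub : ∀ g0 ∈ Matrix.specialUnitaryGroup (Fin n) ℂ, ∀ g ∈ liftedReachable U Hmat g0,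
      g ∈ Matrix.specialUnitaryGroup (Fin n) ℂ := by
    rintro g0 hg0 _ ⟨T, hT, u, p, hu, hp, rfl, rfl⟩
    exact part1 T u p hT hu hp hg0 T ⟨hT, le_rfl⟩
  refine ⟨part1, ?_, ?_⟩
  · intro hdense
    have hd1 : (Matrix.specialUnitaryGroup (Fin n) ℂ : Set (Matrix (Fin n) (Fin n) ℂ)) ⊆
      @closure _ instTopologicalSpaceMatrix (liftedReachable U Hmat 1) :=
      hdense 1 (one_mem _)
    obtain ⟨v, hv, hne⟩ := exists_ham_ne_zero hn hd1
    let S : Submonoid (Matrix (Fin n) (Fin n) ℂ) :=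
      { carrier := liftedReachable U Hmat 1
        mul_mem' := fun ha hb => reach_mul ha hb
        one_mem' := by
          have := reach_exp (Hmat := Hmat) hv (hherm v hv) (le_refl (0 : ℝ))
          rwa [zero_smul, NormedSpace.exp_zero] at this }
    have hall : ∀ g ∈ Matrix.specialUnitaryGroup (Fin n) ℂ, g ∈ S :=
      su_of_dense hn S (hsub 1 (one_mem _)) hd1 (Hmat v) (hherm v hv) (htrace v hv) hne
        (fun t ht => reach_exp hv (hherm v hv) ht)
    intro g0 hg0
    refine Set.Subset.antisymm (hsub g0 hg0) ?_
    intro g hg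
    obtain ⟨hu0, hdet0⟩ := Matrix.mem_specialUnitaryGroup_iff.1 hg0
    have hstar : star g0 ∈ Matrix.specialUnitaryGroup (Fin n) ℂ := by
      refine Matrix.mem_specialUnitaryGroup_iff.2 ⟨Unitary.star_mem hu0, ?_⟩
      rw [Matrix.star_eq_conjTranspose, Matrix.det_conjTranspose, hdet0, star_one]
    have h1 : g * star g0 ∈ liftedReachable U Hmat 1 := hall _ (mul_mem hg hstar)
    have h2 := reach_mul_right h1 hu0
    rwa [mul_assoc, Matrix.mem_unitaryGroup_iff'.1 hu0, mul_one] at h2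
  · intro h g0 hg0
    rw [h g0 hg0]
    exact subset_closure
end
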